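/- arXiv:2507.18045 — 2 statements merged into one kernel-verified Lean document; each statement's English description precedes it below -/
import Mathlib

section
/- Let n ≥ 1 be an integer such that p = 4n⁴ + 12n² + 1 is prime, let α be a generator of the multiplicative group of ℤ/pℤ, and let C_i (0 ≤ i ≤ 7) be the order-8 cyclotomic cosets with respect to α. Then at least one of the following holds: (1) both (C_0 ∪ C_1, C_4 ∪ C_5) and (C_0 ∪ C_7, C_3 ∪ C_4) are ((p−1)/16)-fold near-factorizations of the additive group ℤ/pℤ, or (2) both (C_0 ∪ C_5, C_1 ∪ C_4) and (C_0 ∪ C_3, C_4 ∪ C_7) are ((p−1)/16)-fold near-factorizations of the additive group ℤ/pℤ. In each case both subsets of each pair have cardinality (p−1)/4. -/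
theorem sq_eq_sq_of_add_mul_sq_eq_prime {p k : ℤ} (hp : Prime p) (hodd : Odd p) (hk : 0 < k)
    {c d x y : ℤ} (h₁ : c ^ 2 + k * d ^ 2 = p) (h₂ : x ^ 2 + k * y ^ 2 = p)
    (hd : Even d) (hy : Even y) : c ^ 2 = x ^ 2 ∧ d ^ 2 = y ^ 2 := by
  have hp0 : p ≠ 0 := hp.ne_zero
  have key : ∀ t s : ℤ, Even t → s ^ 2 + k * t ^ 2 = p ^ 2 → p ∣ t → t = 0 := by
    rintro t s ht hst ⟨u, rfl⟩
    have hu : Even u := by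
      rcases Int.even_mul.mp ht with h | h
      · exact absurd hodd (Int.not_odd_iff_even.mpr h)
      · exact h
    obtain ⟨w, rfl⟩ := hu
    have hw : w = 0 := by
      by_contra hw
      have h1 : 1 ≤ w ^ 2 := by have := sq_pos_of_ne_zero hw; omega
      have h2 : 0 < p ^ 2 := by positivity
      have h3 : p ^ 2 ≤ p ^ 2 * w ^ 2 := by nlinarith
      have h4 : p ^ 2 * w ^ 2 ≤ k * (p ^ 2 * w ^ 2) := by nlinarith
      nlinarith [sq_nonneg s]
    simp [hw]
  have hdvd : p ∣ (c * y - x * d) * (c * y + x * d) :=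
    ⟨y ^ 2 - d ^ 2, by linear_combination (y ^ 2) * h₁ - d ^ 2 * h₂⟩
  have hprod : (c * y - x * d) * (c * y + x * d) = 0 := by
    rcases hp.dvd_or_dvd hdvd with h | h
    · rw [key _ (c * x + k * d * y) ((hy.mul_left c).sub (hd.mul_left x))
        (by linear_combination (c ^ 2 + k * d ^ 2) * h₂ + p * h₁) h, zero_mul]
    · rw [key _ (c * x - k * d * y) ((hy.mul_left c).add (hd.mul_left x))
        (by linear_combination (c ^ 2 + k * d ^ 2) * h₂ + p * h₁) h, mul_zero]
  have hyd : p * (y ^ 2 - d ^ 2) = 0 := by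
    linear_combination hprod - (y ^ 2) * h₁ + d ^ 2 * h₂
  have hyd' : d ^ 2 = y ^ 2 := by
    rcases mul_eq_zero.mp hyd with h | h
    · exact absurd h hp0
    · linarith
  exact ⟨by linear_combination h₁ - h₂ - k * hyd', hyd'⟩

open NumberTheorySymbols in
theorem jacobiSym_two_mul_eq_one {n p : ℕ} (hn : 1 ≤ n) (hp : p = 4 * n ^ 4 + 12 * n ^ 2 + 1) :
    J(2 * n | p) = 1 := by
  obtain ⟨k, m, hm, rfl⟩ := Nat.exists_eq_two_pow_mul_odd (by omega : n ≠ 0)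
  have hp4 : p % 4 = 1 := by omega
  have hpodd : Odd p := Nat.odd_iff.mpr (by omega)
  set N := 2 ^ k * m with hN
  have hp8 : p % 8 = 1 := by
    rcases Nat.even_or_odd' N with ⟨t, ht | ht⟩ <;> rw [ht] at hp <;> ring_nf at hp <;> omega
  have h2 : J(2 | p) = 1 := by
    rw [jacobiSym.at_two hpodd, ZMod.χ₈_nat_eq_if_mod_eight]
    simp [hp8, Nat.odd_iff.mp hpodd]
  have hm1 : J(m | p) = 1 := by
    rw [← jacobiSym.quadratic_reciprocity_one_mod_four hp4 hm,
      jacobiSym.mod_left' (a₂ := 1) _, jacobiSym.one_left]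
    refine (Int.modEq_iff_dvd.mpr ⟨2 ^ k * (4 * N ^ 3 + 12 * N), ?_⟩).symm
    rw [hp, hN]
    push_cast
    ring
  rw [hN]
  push_cast
  rw [jacobiSym.mul_left, jacobiSym.mul_left, jacobiSym.pow_left, h2, hm1]
  simp

open NumberTheorySymbols in
theorem jacobiSym_two_mul_sq_add_one {n p : ℕ} (hp : p = 4 * n ^ 4 + 12 * n ^ 2 + 1) :
    J(2 * n ^ 2 + 1 | p) = (-1) ^ n := by
  have hp4 : p % 4 = 1 := by omega
  have hcodd : Odd (2 * n ^ 2 + 1) := ⟨n ^ 2, rfl⟩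
  have hcop : Int.gcd (2 * n) ((2 * n ^ 2 + 1 : ℕ) : ℤ) = 1 := by
    rw [← Int.isCoprime_iff_gcd_eq_one]
    exact ⟨-n, 1, by push_cast; ring⟩
  have hrec : J(((2 * n ^ 2 + 1 : ℕ) : ℤ) | p) = J(p | 2 * n ^ 2 + 1) :=
    (jacobiSym.quadratic_reciprocity_one_mod_four hp4 hcodd).symm
  have hmod : J(p | 2 * n ^ 2 + 1) = J(2 * (2 * n) ^ 2 | 2 * n ^ 2 + 1) := by
    refine jacobiSym.mod_left' (Int.modEq_iff_dvd.mpr ⟨2 * n ^ 2 + 1, ?_⟩).symm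
    rw [hp]
    push_cast
    ring
  have : J(2 * n ^ 2 + 1 | p) = J(2 | 2 * n ^ 2 + 1) := by
    push_cast at hrec
    rw [hrec, hmod, jacobiSym.mul_left, jacobiSym.sq_one' hcop, mul_one]
  rw [this, jacobiSym.at_two hcodd, ZMod.χ₈_nat_eq_if_mod_eight]
  rcases Nat.even_or_odd' n with ⟨t, ht | ht⟩
  · have : (2 * n ^ 2 + 1) % 8 = 1 := by rw [ht]; ring_nf; omega
    have h2 : (2 * n ^ 2 + 1) % 2 = 1 := by omega
    rw [this, h2, ht]
    simp
  · have : (2 * n ^ 2 + 1) % 8 = 3 := by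
      obtain ⟨s, hs⟩ := (Nat.even_mul_succ_self t)
      have : 2 * n ^ 2 + 1 = 8 * (t * (t + 1)) + 3 := by rw [ht]; ring
      omega
    have h2 : (2 * n ^ 2 + 1) % 2 = 1 := by omega
    rw [this, h2, ht]
    simp [pow_add, pow_mul]

open Finset

section

variable {p : ℕ} [Fact p.Prime]

theorem sum_comp_sq_eq_sum_quadraticChar (hp : p ≠ 2) (f : ZMod p → ℂ) :
    ∑ y, f (y ^ 2) = ∑ t, (1 + (quadraticChar (ZMod p) t : ℂ)) * f t := by
  have hF : ringChar (ZMod p) ≠ 2 := by rwa [ZMod.ringChar_zmod_n]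
  rw [← Finset.sum_fiberwise univ (fun y : ZMod p ↦ y ^ 2) (fun y ↦ f (y ^ 2))]
  refine Finset.sum_congr rfl fun t _ ↦ ?_
  have hcard := quadraticChar_card_sqrts hF t
  have hset : ({x : ZMod p | x ^ 2 = t} : Set (ZMod p)).toFinset = univ.filter (fun x ↦ x ^ 2 = t) := by
    ext; simp
  rw [hset] at hcard
  rw [Finset.sum_congr rfl (g := fun _ ↦ f t) (by
    intro y hy; rw [(Finset.mem_filter.mp hy).2]), Finset.sum_const, nsmul_eq_mul]
  congr 1
  rw [add_comm]
  exact_mod_cast hcard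

theorem sum_apply_one_sub_sq (hp : p ≠ 2) {χ ρ : MulChar (ZMod p) ℂ} (hχ : χ ≠ 1)
    (hρ : ∀ t, ρ t = (quadraticChar (ZMod p) t : ℂ)) :
    ∑ y, χ (1 - y ^ 2) = jacobiSum χ ρ := by
  rw [sum_comp_sq_eq_sum_quadraticChar hp (fun t ↦ χ (1 - t)), jacobiSum_comm, jacobiSum]
  simp only [add_mul, one_mul, Finset.sum_add_distrib, hρ]
  have h0 : ∑ t, χ (1 - t) = 0 :=
    ((Equiv.subLeft (1 : ZMod p)).sum_comp χ).trans (MulChar.sum_eq_zero_of_ne_one hχ)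
  rw [h0, zero_add]

theorem apply_four_mul_jacobiSum_self (hp : p ≠ 2) {χ ρ : MulChar (ZMod p) ℂ} (hχ : χ ≠ 1)
    (hρ : ∀ t, ρ t = (quadraticChar (ZMod p) t : ℂ)) :
    χ 4 * jacobiSum χ χ = jacobiSum χ ρ := by
  have h2 : (2 : ZMod p) ≠ 0 :=
    Ring.two_ne_zero (by rwa [ZMod.ringChar_zmod_n])
  rw [← sum_apply_one_sub_sq hp hχ hρ, jacobiSum, Finset.mul_sum]
  refine Finset.sum_bij (fun x _ ↦ 2 * x - 1) (by simp)
    (fun x _ y _ h ↦ mul_left_cancel₀ h2 (sub_left_injective h))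
    (fun y _ ↦ ⟨(y + 1) / 2, mem_univ _, by field_simp; ring⟩) (fun x _ ↦ ?_)
  rw [← map_mul, ← map_mul]
  congr 1
  ring

theorem jacobiSum_relations {χ : MulChar (ZMod p) ℂ} (hχ : orderOf χ = 8)
    (hneg : χ (-1) = 1) (hp : p ≠ 2)
    (hρ : ∀ t, (χ ^ 4) t = (quadraticChar (ZMod p) t : ℂ)) (h4 : χ 4 ^ 2 = 1) :
    jacobiSum χ (χ ^ 3) = jacobiSum χ (χ ^ 4) ∧
    jacobiSum χ χ = χ 4 * jacobiSum χ (χ ^ 4) ∧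
    jacobiSum (χ ^ 2) (χ ^ 2) = jacobiSum (χ ^ 2) (χ ^ 4) ∧
    jacobiSum χ (χ ^ 5) = χ 4 * jacobiSum (χ ^ 2) (χ ^ 4) := by
  have hne (j : ℕ) (hj : ¬ 8 ∣ j) : χ ^ j ≠ 1 := by
    rwa [ne_eq, ← orderOf_dvd_iff_pow_eq_one, hχ]
  have h8 : χ ^ 8 = 1 := hχ ▸ pow_orderOf_eq_one χ
  set ψ : AddChar (ZMod p) ℂ := ZMod.stdAddChar
  have hψ : ψ.IsPrimitive := ZMod.isPrimitive_stdAddChar p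
  have hcard : (Fintype.card (ZMod p) : ℂ) ≠ 0 := by simp [(Fact.out : p.Prime).ne_zero]
  have hJ (i j : ℕ) (hij : ¬ 8 ∣ i + j) : gaussSum (χ ^ (i + j)) ψ * jacobiSum (χ ^ i) (χ ^ j) =
      gaussSum (χ ^ i) ψ * gaussSum (χ ^ j) ψ := by
    rw [pow_add]
    exact jacobiSum_mul_nontrivial (by rw [← pow_add]; exact hne _ hij) ψ
  have hG (i j : ℕ) (hi : ¬ 8 ∣ i) (hij : i + j = 8) :
      gaussSum (χ ^ i) ψ * gaussSum (χ ^ j) ψ = Fintype.card (ZMod p) := by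
    have hinv : (χ ^ i)⁻¹ = χ ^ j := by
      rw [inv_eq_iff_mul_eq_one, ← pow_add, hij, h8]
    rw [← gaussSum_mul_gaussSum_eq_card (hne i hi) hψ, hinv, ← mul_gaussSum_inv_eq_gaussSum (χ ^ j) ψ,
      MulChar.pow_apply' _ (by omega), hneg, one_pow, one_mul]
  have hg (i : ℕ) (hi : ¬ 8 ∣ i) : gaussSum (χ ^ i) ψ ≠ 0 :=
    gaussSum_ne_zero_of_nontrivial hcard (hne i hi) hψ
  have h11 : χ 4 * jacobiSum χ χ = jacobiSum χ (χ ^ 4) :=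
    apply_four_mul_jacobiSum_self hp (by simpa using hne 1 (by norm_num)) hρ
  have h22 := apply_four_mul_jacobiSum_self hp (hne 2 (by norm_num)) hρ
  rw [MulChar.pow_apply' _ (by norm_num), h4, one_mul] at h22
  have e11 := hJ 1 1 (by norm_num)
  have e13 := hJ 1 3 (by norm_num)
  have e14 := hJ 1 4 (by norm_num)
  have e15 := hJ 1 5 (by norm_num)
  have e24 := hJ 2 4 (by norm_num)
  have e44 := hG 4 4 (by norm_num) rfl
  have e53 := hG 5 3 (by norm_num) rfl
  have n1 := hg 1 (by norm_num)
  have n6 := hg 6 (by norm_num)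
  norm_num only [pow_one] at e11 e13 e14 e15 e24 e44 e53 n1 n6
  have h15 : gaussSum (χ ^ 6) ψ * jacobiSum χ (χ ^ 5) =
      χ 4 * (gaussSum (χ ^ 6) ψ * jacobiSum (χ ^ 2) (χ ^ 4)) := by
    apply mul_left_cancel₀ n1
    rw [e15, e24]
    linear_combination
      (- gaussSum χ ψ ^ 2 * gaussSum (χ ^ 5) ψ) * h4 - χ 4 ^ 2 * gaussSum (χ ^ 5) ψ * e11
      + χ 4 * gaussSum (χ ^ 5) ψ * gaussSum (χ ^ 2) ψ * h11 + χ 4 * gaussSum (χ ^ 2) ψ * e14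
  refine ⟨?_, ?_, h22, ?_⟩
  · apply mul_left_cancel₀ hcard
    linear_combination (-jacobiSum χ (χ ^ 3)) * e44 + jacobiSum χ (χ ^ 4) * e53
      + gaussSum (χ ^ 4) ψ * e13 - gaussSum (χ ^ 3) ψ * e14
  · linear_combination χ 4 * h11 - jacobiSum χ χ * h4
  · exact mul_left_cancel₀ n6 (h15.trans (by ring))

end

section

variable {p : ℕ} [Fact p.Prime]

theorem sum_apply_one_sub_sq_pow {χ : MulChar (ZMod p) ℂ} {ζ : ℂ} (hζ : IsPrimitiveRoot ζ 8)
    (hχ : ∀ x, χ x = 0 ∨ χ x ^ 8 = 1) {e : ℕ} (he : e ≠ 0) :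
    ∑ y, χ (1 - y ^ 2) ^ e =
      ∑ k ∈ range 8, (#{y | χ (1 - y ^ 2) = ζ ^ k} : ℂ) * (ζ ^ k) ^ e := by
  simp only [Finset.card_filter, Nat.cast_sum, Finset.sum_mul]
  rw [Finset.sum_comm]
  refine Finset.sum_congr rfl fun y _ ↦ ?_
  have hζ0 : ζ ≠ 0 := hζ.ne_zero (by norm_num)
  rcases hχ (1 - y ^ 2) with h | h
  · simp [h, he, (pow_ne_zero _ hζ0).symm]
  · obtain ⟨i, hi, hi'⟩ := hζ.eq_pow_of_pow_eq_one h
    rw [Finset.sum_eq_single i, ← hi']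
    · simp
    · intro k hk hki
      rw [if_neg, Nat.cast_zero, zero_mul]
      rw [← hi']
      exact fun h' ↦ hki (hζ.pow_inj hi (mem_range.mp hk) h').symm
    · intro h'; exact absurd (mem_range.mpr hi) h'

theorem sum_card_apply_one_sub_sq (hp : p ≠ 2) {χ : MulChar (ZMod p) ℂ} {ζ : ℂ}
    (hζ : IsPrimitiveRoot ζ 8) (hχ : ∀ x, χ x = 0 ∨ χ x ^ 8 = 1) :
    (∑ k ∈ range 8, #{y | χ (1 - y ^ 2) = ζ ^ k}) + 2 = p := by
  have h := sum_apply_one_sub_sq_pow hζ hχ (e := 8) (by norm_num)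
  have h1 (k : ℕ) : (ζ ^ k) ^ 8 = 1 := by rw [← pow_mul, mul_comm, pow_mul, hζ.pow_eq_one, one_pow]
  simp only [h1, mul_one] at h
  have h2 : ∀ y : ZMod p, χ (1 - y ^ 2) ^ 8 = if y ∈ ({1, -1} : Finset (ZMod p)) then 0 else 1 := by
    intro y
    have hy : y ∈ ({1, -1} : Finset (ZMod p)) ↔ 1 - y ^ 2 = 0 := by
      rw [sub_eq_zero, eq_comm (a := (1 : ZMod p)), sq_eq_one_iff]; simp
    split_ifs with h'
    · rw [hy.mp h', χ.map_zero, zero_pow (by norm_num)]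
    · refine (hχ _).resolve_left fun h0 ↦ h' (hy.mpr ?_)
      by_contra h3
      exact (IsUnit.map χ (isUnit_iff_ne_zero.mpr h3)).ne_zero h0
  simp only [h2] at h
  have hcard : #({1, -1} : Finset (ZMod p)) = 2 := by
    rw [Finset.card_pair]
    exact (Ring.neg_one_ne_one_of_char_ne_two (by rwa [ZMod.ringChar_zmod_n])).symm
  have h3 : ∑ y : ZMod p, (if y ∈ ({1, -1} : Finset (ZMod p)) then (0 : ℂ) else 1) + 2 = p := by
    have : ∀ y : ZMod p, (if y ∈ ({1, -1} : Finset (ZMod p)) then (0 : ℂ) else 1) =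
      1 - if y ∈ ({1, -1} : Finset (ZMod p)) then 1 else 0 := by
      intro y; split_ifs <;> simp
    rw [Finset.sum_congr rfl fun y _ ↦ this y, Finset.sum_sub_distrib, Finset.sum_ite_mem,
      Finset.univ_inter, Finset.sum_const, Finset.sum_const, hcard]
    simp [ZMod.card]
  rw [h] at h3
  exact_mod_cast h3

theorem even_card_apply_one_sub_sq (hp : p ≠ 2) {χ : MulChar (ZMod p) ℂ} {u : ℂ} (hu : u ≠ 1) :
    Even #{y | χ (1 - y ^ 2) = u} := by
  rw [← ZMod.natCast_eq_zero_iff_even, Finset.card_eq_sum_ones, Nat.cast_sum]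
  refine Finset.sum_involution (fun y _ ↦ -y) (fun _ _ ↦ by decide) (fun y hy _ h ↦ ?_)
    (fun y hy ↦ by simpa using hy) (fun y _ ↦ neg_neg y)
  have hy0 : y = 0 := by
    have : (2 : ZMod p) * y = 0 := by linear_combination -h
    exact (mul_eq_zero.mp this).resolve_left
      (Ring.two_ne_zero (by rwa [ZMod.ringChar_zmod_n]))
  rw [Finset.mem_filter, hy0] at hy
  exact hu (by simpa using hy.2.symm)

theorem exists_int_jacobiSum_eq {χ : MulChar (ZMod p) ℂ} (hord : orderOf χ = 8) {ζ : ℂ}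
    (hζ : IsPrimitiveRoot ζ 8) (hχ : ∀ x, χ x = 0 ∨ χ x ^ 8 = 1) (hp8 : p % 8 = 1)
    (hneg : χ (-1) = 1) (hρ : ∀ t, (χ ^ 4) t = (quadraticChar (ZMod p) t : ℂ))
    (h4 : χ 4 ^ 2 = 1) :
    ∃ a b c d : ℤ, jacobiSum (χ ^ 2) (χ ^ 4) = a + b * ζ ^ 2 ∧
      jacobiSum (χ ^ 6) (χ ^ 4) = a - b * ζ ^ 2 ∧
      jacobiSum χ (χ ^ 4) = c + d * (ζ + ζ ^ 3) ∧
      jacobiSum (χ ^ 7) (χ ^ 4) = c - d * (ζ + ζ ^ 3) ∧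
      a % 4 = 3 ∧ c % 4 = 3 ∧ Even b ∧ Even d ∧ c ^ 2 + 2 * d ^ 2 = p ∧ a ^ 2 + 1 * b ^ 2 = p := by
  have hp : p ≠ 2 := by rintro rfl; norm_num at hp8
  have hne (j : ℕ) (hj : ¬ 8 ∣ j) : χ ^ j ≠ 1 := by
    rwa [ne_eq, ← orderOf_dvd_iff_pow_eq_one, hord]
  have h8 : χ ^ 8 = 1 := hord ▸ pow_orderOf_eq_one χ
  have hζ4 : ζ ^ 4 = -1 := by
    have h1 : (ζ ^ 4) ^ 2 = 1 := by rw [← pow_mul]; exact hζ.pow_eq_one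
    exact (sq_eq_one_iff.mp h1).resolve_left (hζ.pow_ne_one_of_pos_of_lt (by norm_num) (by norm_num))
  set m : ℕ → ℤ := fun k ↦ #{y | χ (1 - y ^ 2) = ζ ^ k} with hm
  have hsum : m 0 + m 1 + m 2 + m 3 + m 4 + m 5 + m 6 + m 7 + 2 = p := by
    have := sum_card_apply_one_sub_sq hp hζ hχ
    simp only [Finset.sum_range_succ, Finset.sum_range_zero] at this
    simp only [hm]
    zify at this
    rw [← this]; ring
  have heven (k : ℕ) (hk : k ≠ 0) (hk8 : k < 8) : m k % 2 = 0 :=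
    Int.even_iff.mp ((Int.even_coe_nat _).mpr
      (even_card_apply_one_sub_sq hp (hζ.pow_ne_one_of_pos_of_lt hk hk8)))
  have hJ (e : ℕ) (he : ¬ 8 ∣ e) : jacobiSum (χ ^ e) (χ ^ 4) =
      m 0 + m 1 * ζ ^ e + m 2 * ζ ^ (2 * e) + m 3 * ζ ^ (3 * e) + m 4 * ζ ^ (4 * e)
        + m 5 * ζ ^ (5 * e) + m 6 * ζ ^ (6 * e) + m 7 * ζ ^ (7 * e) := by
    have he0 : e ≠ 0 := by rintro rfl; simp at he
    rw [← sum_apply_one_sub_sq hp (hne e he) hρ]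
    simp only [MulChar.pow_apply' _ he0]
    rw [sum_apply_one_sub_sq_pow hζ hχ he0]
    simp only [Finset.sum_range_succ, Finset.sum_range_zero, hm, ← pow_mul]
    push_cast
    simp
  have j1 := hJ 1 (by norm_num)
  have j2 := hJ 2 (by norm_num)
  have j3 := hJ 3 (by norm_num)
  have j6 := hJ 6 (by norm_num)
  have j7 := hJ 7 (by norm_num)
  norm_num only [pow_one] at j1 j2 j3 j6 j7
  have h13 : jacobiSum (χ ^ 3) (χ ^ 4) = jacobiSum χ (χ ^ 4) := by
    have hord3 : orderOf (χ ^ 3) = 8 := by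
      rw [Nat.Coprime.orderOf_pow (by rw [hord]; norm_num), hord]
    have e9 : (χ ^ 3) ^ 3 = χ := by rw [← pow_mul, show 3 * 3 = 8 + 1 by rfl, pow_add, h8]; simp
    have e12 : (χ ^ 3) ^ 4 = χ ^ 4 := by
      rw [← pow_mul, show 3 * 4 = 8 + 4 by rfl, pow_add, h8, one_mul]
    have r3 := (jacobiSum_relations hord3 (by rw [MulChar.pow_apply' _ (by norm_num), hneg, one_pow])
      hp (by rw [e12]; exact hρ)
      (by rw [MulChar.pow_apply' _ (by norm_num), ← pow_mul, mul_comm, pow_mul, h4, one_pow])).1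
    rw [e9, e12] at r3
    rw [← r3, jacobiSum_comm, (jacobiSum_relations hord hneg hp hρ h4).1]
  have hlin : (m 1 - m 5 - (m 3 - m 7) : ℂ) * (ζ - ζ ^ 3) = - 2 * (m 2 - m 6) * ζ ^ 2 := by
    rw [j1, j3] at h13
    grind
  have hsq : (m 1 - m 5 - (m 3 - m 7)) ^ 2 + 2 * (m 2 - m 6) ^ 2 = 0 := by
    have : ((m 1 - m 5 - (m 3 - m 7)) ^ 2 + 2 * (m 2 - m 6) ^ 2 : ℂ) = 0 := by
      grind
    exact_mod_cast this
  have hu2 : m 2 - m 6 = 0 := by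
    have := sq_nonneg (m 1 - m 5 - (m 3 - m 7))
    have := sq_nonneg (m 2 - m 6)
    exact pow_eq_zero_iff (two_ne_zero) |>.mp (by linarith)
  have hu1 : m 1 - m 5 - (m 3 - m 7) = 0 := by
    rw [hu2] at hsq
    exact pow_eq_zero_iff (two_ne_zero) |>.mp (by linarith)
  have c2 : (m 6 : ℂ) = m 2 := by exact_mod_cast (sub_eq_zero.mp hu2).symm
  have c7 : (m 7 : ℂ) = m 3 - m 1 + m 5 := by
    have : m 7 = m 3 - m 1 + m 5 := by linarith
    exact_mod_cast this
  set a : ℤ := m 0 + m 4 - m 2 - m 6 with ha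
  set b : ℤ := m 1 + m 5 - m 3 - m 7 with hb
  set c : ℤ := m 0 - m 4 with hc
  set d : ℤ := m 1 - m 5 with hd
  have k1 : jacobiSum χ (χ ^ 4) = c + d * (ζ + ζ ^ 3) := by
    rw [j1, c2, c7, hc, hd]; push_cast; grind
  have k7 : jacobiSum (χ ^ 7) (χ ^ 4) = c - d * (ζ + ζ ^ 3) := by
    rw [j7, c2, c7, hc, hd]; push_cast; grind
  have k2 : jacobiSum (χ ^ 2) (χ ^ 4) = a + b * ζ ^ 2 := by
    rw [j2, ha, hb]; push_cast; grind
  have k6 : jacobiSum (χ ^ 6) (χ ^ 4) = a - b * ζ ^ 2 := by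
    rw [j6, ha, hb]; push_cast; grind
  have hnorm (i j : ℕ) (hi : ¬ 8 ∣ i) (hi4 : ¬ 8 ∣ i + 4) (hij : i + j = 8) :
      jacobiSum (χ ^ i) (χ ^ 4) * jacobiSum (χ ^ j) (χ ^ 4) = p := by
    have := jacobiSum_mul_jacobiSum_inv (F := ZMod p) (F' := ℂ)
      (by rw [ringChar.eq_zero, ZMod.ringChar_zmod_n]; exact (Fact.out : p.Prime).ne_zero.symm)
      (hne i hi) (hne 4 (by norm_num)) (by rw [← pow_add]; exact hne _ hi4)
    rwa [inv_eq_of_mul_eq_one_right (b := χ ^ j) (by rw [← pow_add, hij, h8]),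
      inv_eq_of_mul_eq_one_right (b := χ ^ 4) (by rw [← pow_add, h8]), ZMod.card] at this
  have n17 := hnorm 1 7 (by norm_num) (by norm_num) rfl
  have n26 := hnorm 2 6 (by norm_num) (by norm_num) rfl
  rw [pow_one, k1, k7] at n17
  rw [k2, k6] at n26
  have hcd : c ^ 2 + 2 * d ^ 2 = p := by
    have : (c ^ 2 + 2 * d ^ 2 : ℂ) = p := by grind
    exact_mod_cast this
  have hab : a ^ 2 + 1 * b ^ 2 = p := by
    have : (a ^ 2 + 1 * b ^ 2 : ℂ) = p := by grind
    exact_mod_cast this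
  have p1 := heven 1 (by norm_num) (by norm_num)
  have p2 := heven 2 (by norm_num) (by norm_num)
  have p3 := heven 3 (by norm_num) (by norm_num)
  have p4 := heven 4 (by norm_num) (by norm_num)
  have p5 := heven 5 (by norm_num) (by norm_num)
  have p6 := heven 6 (by norm_num) (by norm_num)
  have p7 := heven 7 (by norm_num) (by norm_num)
  have hdeven : d % 2 = 0 := by omega
  have hbeven : b % 2 = 0 := by omega
  exact ⟨a, b, c, d, k2, k6, k1, k7, by omega, by omega, Int.even_iff.mpr hbeven,
    Int.even_iff.mpr hdeven, hcd, hab⟩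

end

theorem sum_weighted_jacobiSum {ζ z P ε a b c d : ℂ} {J : ℕ → ℕ → ℂ} (hζ : ζ ^ 4 = -1)
    (hz : z ^ 8 = 1) (hε : ε ^ 2 = 1) (hb : b = 2 * d) (hac : c + a = -2 * ε)
    (hsymm : ∀ i j, J i j = J j i) (h88 : J 8 8 = P - 2) (h28 : J 2 8 = -1) (h68 : J 6 8 = -1)
    (h26 : J 2 6 = -1) (h17 : J 1 7 = -1) (h35 : J 3 5 = -1)
    (h22 : J 2 2 = a + b * ζ ^ 2) (h66 : J 6 6 = a - b * ζ ^ 2)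
    (h13 : J 1 3 = c + d * (ζ + ζ ^ 3)) (h57 : J 5 7 = c - d * (ζ + ζ ^ 3))
    (h11 : J 1 1 = ε * J 1 3) (h33 : J 3 3 = ε * J 1 3)
    (h55 : J 5 5 = ε * J 5 7) (h77 : J 7 7 = ε * J 5 7)
    (h15 : J 1 5 = ε * J 2 2) (h37 : J 3 7 = ε * J 6 6) :
    ∑ i ∈ Icc 1 8, ∑ j ∈ Icc 1 8, (1 + (-ζ ^ 3) ^ i) * ((-1) ^ j * (1 + (-ζ ^ 3) ^ j)) *
      (z ^ (i + j) * J i j) = 4 * (P - 1) := by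
  set A : ℕ → ℂ := fun j ↦ 1 + (-ζ ^ 3) ^ j with hA
  have a1 : A 1 = 1 - ζ ^ 3 := by simp only [hA]; ring
  have a2 : A 2 = 1 - ζ ^ 2 := by simp only [hA]; linear_combination ζ ^ 2 * hζ
  have a3 : A 3 = 1 - ζ := by simp only [hA]; linear_combination (-ζ ^ 5 + ζ) * hζ
  have a4 : A 4 = 0 := by
    simp only [hA]; linear_combination (ζ ^ 8 - ζ ^ 4 + 1) * hζ
  have a5 : A 5 = 1 + ζ ^ 3 := by
    simp only [hA]; linear_combination (-ζ ^ 11 + ζ ^ 7 - ζ ^ 3) * hζ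
  have a6 : A 6 = 1 + ζ ^ 2 := by
    simp only [hA]; linear_combination (ζ ^ 14 - ζ ^ 10 + ζ ^ 6 - ζ ^ 2) * hζ
  have a7 : A 7 = 1 + ζ := by
    simp only [hA]
    linear_combination (-ζ ^ 17 + ζ ^ 13 - ζ ^ 9 + ζ ^ 5 - ζ) * hζ
  have a8 : A 8 = 2 := by
    simp only [hA]
    linear_combination (ζ ^ 20 - ζ ^ 16 + ζ ^ 12 - ζ ^ 8 + ζ ^ 4 - 1) * hζ
  have hIcc : Icc 1 8 = ({1, 2, 3, 4, 5, 6, 7, 8} : Finset ℕ) := by decide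
  have key : ∑ i ∈ Icc 1 8, ∑ j ∈ Icc 1 8, A i * ((-1) ^ j * A j) * (z ^ (i + j) * J i j) =
      4 * (P - 2) * (z ^ 8 * z ^ 8) - 4 * (1 - ζ ^ 2) * (z ^ 8 * z ^ 2)
        - 4 * (1 + ζ ^ 2) * (z ^ 8 * z ^ 6)
        + (1 - ζ ^ 2) ^ 2 * (z ^ 4 * J 2 2) + (1 + ζ ^ 2) ^ 2 * (z ^ 8 * z ^ 4 * J 6 6)
        - 2 * (1 - ζ ^ 2) * (1 + ζ ^ 2) * z ^ 8
        - (1 - ζ ^ 3) ^ 2 * (z ^ 2 * (ε * J 1 3)) - (1 - ζ) ^ 2 * (z ^ 6 * (ε * J 1 3))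
        - (1 + ζ ^ 3) ^ 2 * (z ^ 8 * z ^ 2 * (ε * J 5 7))
        - (1 + ζ) ^ 2 * (z ^ 8 * z ^ 6 * (ε * J 5 7))
        - 2 * (1 - ζ ^ 3) * (1 - ζ) * (z ^ 4 * J 1 3)
        - 2 * (1 - ζ ^ 3) * (1 + ζ ^ 3) * (z ^ 6 * (ε * J 2 2))
        + 2 * (1 - ζ ^ 3) * (1 + ζ) * z ^ 8 + 2 * (1 - ζ) * (1 + ζ ^ 3) * z ^ 8
        - 2 * (1 - ζ) * (1 + ζ) * (z ^ 8 * z ^ 2 * (ε * J 6 6))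
        - 2 * (1 + ζ ^ 3) * (1 + ζ) * (z ^ 8 * z ^ 4 * J 5 7) := by
    rw [hIcc]
    simp only [Finset.sum_insert, Finset.mem_insert, Finset.mem_singleton, Finset.sum_singleton,
      Nat.reduceEqDiff, OfNat.one_ne_ofNat, not_false_eq_true, or_self,
      a1, a2, a3, a4, a5, a6, a7, a8, zero_mul, mul_zero, zero_add]
    simp only [hsymm 2 1, hsymm 3 1, hsymm 5 1, hsymm 6 1, hsymm 7 1, hsymm 8 1, hsymm 3 2,
      hsymm 5 2, hsymm 6 2, hsymm 7 2, hsymm 8 2, hsymm 5 3, hsymm 6 3, hsymm 7 3, hsymm 8 3,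
      hsymm 6 5, hsymm 7 5, hsymm 8 5, hsymm 7 6, hsymm 8 6, hsymm 8 7,
      h88, h28, h68, h26, h17, h35, h11, h33, h55, h77, h15, h37]
    ring
  rw [key, h22, h66, h13, h57, hz, hb, show a = -2 * ε - c by linear_combination hac]
  have t2 : -4 * (1 - ζ ^ 2) - (1 - ζ ^ 3) ^ 2 * (ε * (c + d * (ζ + ζ ^ 3)))
        - (1 + ζ ^ 3) ^ 2 * (ε * (c - d * (ζ + ζ ^ 3)))
        - 2 * (1 - ζ) * (1 + ζ) * (ε * (-2 * ε - c - 2 * d * ζ ^ 2)) = 0 := by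
    grind
  have t6 : - 4 * (1 + ζ ^ 2) - (1 - ζ) ^ 2 * (ε * (c + d * (ζ + ζ ^ 3)))
        - (1 + ζ) ^ 2 * (ε * (c - d * (ζ + ζ ^ 3)))
        - 2 * (1 - ζ ^ 3) * (1 + ζ ^ 3) * (ε * (-2 * ε - c + 2 * d * ζ ^ 2)) = 0 := by
    grind
  have t4 : (1 - ζ ^ 2) ^ 2 * (-2 * ε - c + 2 * d * ζ ^ 2)
        + (1 + ζ ^ 2) ^ 2 * (-2 * ε - c - 2 * d * ζ ^ 2)
        - 2 * (1 - ζ ^ 3) * (1 - ζ) * (c + d * (ζ + ζ ^ 3))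
        - 2 * (1 + ζ ^ 3) * (1 + ζ) * (c - d * (ζ + ζ ^ 3)) = 0 := by
    grind
  have t0 : 4 * (P - 2) - 2 * (1 - ζ ^ 2) * (1 + ζ ^ 2) + 2 * (1 - ζ ^ 3) * (1 + ζ)
        + 2 * (1 - ζ) * (1 + ζ ^ 3) = 4 * (P - 1) := by
    grind
  linear_combination z ^ 2 * t2 + z ^ 6 * t6 + z ^ 4 * t4 + t0

theorem sum_Icc_pow_eq_ite {u : ℂ} (hu : u = 0 ∨ u ^ 8 = 1) :
    ∑ j ∈ Icc 1 8, u ^ j = if u = 1 then 8 else 0 := by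
  split_ifs with h
  · simp [h]
  · have hgeom : (u - 1) * ∑ j ∈ Icc 1 8, u ^ j = 0 := by
      have hIcc : Icc 1 8 = ({1, 2, 3, 4, 5, 6, 7, 8} : Finset ℕ) := by decide
      rw [hIcc]
      simp only [Finset.sum_insert, Finset.mem_insert, Finset.mem_singleton, Finset.sum_singleton,
        Nat.reduceEqDiff, OfNat.one_ne_ofNat, not_false_eq_true, or_self]
      rcases hu with h0 | h8
      · rw [h0]; ring
      · linear_combination u * h8
    exact (mul_eq_zero.mp hgeom).resolve_left (sub_ne_zero.mpr h)

theorem sum_Icc_one_add_mul_pow_eq_ite {ζ w : ℂ} (hζ : ζ ^ 4 = -1) (hw : w = 0 ∨ w ^ 8 = 1) :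
    ∑ j ∈ Icc 1 8, (1 + (-ζ ^ 3) ^ j) * w ^ j = if w = 1 ∨ w = ζ then 8 else 0 := by
  have hζ1 : ζ ≠ 1 := by rintro rfl; norm_num at hζ
  have h1 : -ζ ^ 3 * w = 1 ↔ w = ζ :=
    ⟨fun h ↦ by linear_combination w * hζ + ζ * h,
      fun h ↦ by rw [h]; linear_combination -hζ⟩
  have h2 : -ζ ^ 3 * w = 0 ∨ (-ζ ^ 3 * w) ^ 8 = 1 := by
    rcases hw with h | h
    · left; rw [h, mul_zero]
    · right
      rw [mul_pow, h, show (-ζ ^ 3) ^ 8 = (ζ ^ 4) ^ 6 by ring, hζ]; norm_num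
  simp only [add_mul, one_mul, Finset.sum_add_distrib, ← mul_pow]
  rw [sum_Icc_pow_eq_ite hw, sum_Icc_pow_eq_ite h2]
  simp only [h1]
  by_cases hw1 : w = 1
  · simp [hw1, hζ1.symm]
  · simp [hw1]

section

variable {p : ℕ} [Fact p.Prime]

theorem sum_pow_mul_pow_sub_eq_jacobiSum (χ : MulChar (ZMod p) ℂ) {g : ZMod p} (hg : g ≠ 0)
    {i j : ℕ} (hi : i ≠ 0) (hj : j ≠ 0) :
    ∑ x, χ x ^ i * χ (g - x) ^ j = χ g ^ (i + j) * jacobiSum (χ ^ i) (χ ^ j) := by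
  rw [jacobiSum, Finset.mul_sum, ← Equiv.sum_comp (Equiv.mulLeft₀ g hg)]
  refine Finset.sum_congr rfl fun x _ ↦ ?_
  change χ (g * x) ^ i * χ (g - g * x) ^ j = _
  rw [show g - g * x = g * (1 - x) by ring, map_mul, map_mul,
    MulChar.pow_apply' _ hi, MulChar.pow_apply' _ hj]
  ring

theorem ncard_add_eq_of_jacobiSum {χ : MulChar (ZMod p) ℂ} (hord : orderOf χ = 8)
    (hχ : ∀ x ≠ 0, χ x ^ 8 = 1) (hneg : χ (-1) = 1) {ζ ε a b c d : ℂ} (hζ : ζ ^ 4 = -1)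
    (hε : ε ^ 2 = 1) (hb : b = 2 * d) (hac : c + a = -2 * ε)
    (h22 : jacobiSum (χ ^ 2) (χ ^ 2) = a + b * ζ ^ 2)
    (h66 : jacobiSum (χ ^ 6) (χ ^ 6) = a - b * ζ ^ 2)
    (h13 : jacobiSum (χ ^ 1) (χ ^ 3) = c + d * (ζ + ζ ^ 3))
    (h57 : jacobiSum (χ ^ 5) (χ ^ 7) = c - d * (ζ + ζ ^ 3))
    (h11 : jacobiSum (χ ^ 1) (χ ^ 1) = ε * jacobiSum (χ ^ 1) (χ ^ 3))
    (h33 : jacobiSum (χ ^ 3) (χ ^ 3) = ε * jacobiSum (χ ^ 1) (χ ^ 3))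
    (h55 : jacobiSum (χ ^ 5) (χ ^ 5) = ε * jacobiSum (χ ^ 5) (χ ^ 7))
    (h77 : jacobiSum (χ ^ 7) (χ ^ 7) = ε * jacobiSum (χ ^ 5) (χ ^ 7))
    (h15 : jacobiSum (χ ^ 1) (χ ^ 5) = ε * jacobiSum (χ ^ 2) (χ ^ 2))
    (h37 : jacobiSum (χ ^ 3) (χ ^ 7) = ε * jacobiSum (χ ^ 6) (χ ^ 6))
    {g : ZMod p} (hg : g ≠ 0) :
    {st : ZMod p × ZMod p | st.1 ∈ {x | χ x = 1 ∨ χ x = ζ} ∧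
      st.2 ∈ {x | χ x = ζ ^ 4 ∨ χ x = ζ ^ 5} ∧ st.1 + st.2 = g}.ncard = (p - 1) / 16 := by
  have h8 : χ ^ 8 = 1 := hord ▸ pow_orderOf_eq_one χ
  have hne (j : ℕ) (hj : ¬ 8 ∣ j) : χ ^ j ≠ 1 := by
    rwa [ne_eq, ← orderOf_dvd_iff_pow_eq_one, hord]
  have hinv (i j : ℕ) (hi : ¬ 8 ∣ i) (hi0 : i ≠ 0) (hij : i + j = 8) :
      jacobiSum (χ ^ i) (χ ^ j) = -1 := by
    rw [← inv_eq_of_mul_eq_one_right (a := χ ^ i) (b := χ ^ j) (by rw [← pow_add, hij, h8]),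
      jacobiSum_nontrivial_inv (hne i hi), MulChar.pow_apply' _ hi0, hneg, one_pow]
  have h05 : ζ ^ 5 = -ζ := by linear_combination ζ * hζ
  have hχ0 (x : ZMod p) : χ x = 0 ∨ χ x ^ 8 = 1 := by
    rcases eq_or_ne x 0 with rfl | hx
    · left; exact χ.map_zero
    · exact .inr (hχ x hx)
  have hset : {st : ZMod p × ZMod p | st.1 ∈ {x | χ x = 1 ∨ χ x = ζ} ∧
      st.2 ∈ {x | χ x = ζ ^ 4 ∨ χ x = ζ ^ 5} ∧ st.1 + st.2 = g} =
      (fun x ↦ (x, g - x)) '' (univ.filter fun x ↦ (χ x = 1 ∨ χ x = ζ) ∧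
        (-χ (g - x) = 1 ∨ -χ (g - x) = ζ) : Finset (ZMod p)) := by
    ext ⟨s, t⟩
    simp only [Set.mem_ofPred_eq, Set.mem_image, Finset.coe_filter, Finset.mem_univ, true_and,
      Prod.mk.injEq, hζ, h05, neg_eq_iff_eq_neg]
    constructor
    · rintro ⟨hs, ht, hst⟩
      have : t = g - s := by rw [← hst]; ring
      exact ⟨s, ⟨hs, this ▸ ht⟩, rfl, this.symm⟩
    · rintro ⟨x, ⟨hs, ht⟩, rfl, rfl⟩
      exact ⟨hs, ht, by ring⟩
  rw [hset, Set.ncard_image_of_injective _ (fun x y h ↦ (Prod.mk.inj h).1), Set.ncard_coe_finset]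
  have hcount : (64 : ℂ) * #{x | (χ x = 1 ∨ χ x = ζ) ∧ (-χ (g - x) = 1 ∨ -χ (g - x) = ζ)} =
      4 * (p - 1) := by
    rw [← sum_weighted_jacobiSum (J := fun i j ↦ jacobiSum (χ ^ i) (χ ^ j)) (z := χ g) (P := p)
      hζ (hχ g hg) hε hb hac (fun i j ↦ jacobiSum_comm _ _)
      (by simp only [h8]; rw [jacobiSum_one_one, ZMod.card])
      (by simp only [h8]; rw [jacobiSum_comm, jacobiSum_one_nontrivial (hne 2 (by norm_num))])
      (by simp only [h8]; rw [jacobiSum_comm, jacobiSum_one_nontrivial (hne 6 (by norm_num))])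
      (hinv 2 6 (by norm_num) (by norm_num) rfl) (hinv 1 7 (by norm_num) (by norm_num) rfl)
      (hinv 3 5 (by norm_num) (by norm_num) rfl) h22 h66 h13 h57 h11 h33 h55 h77 h15 h37]
    have hterm (x : ZMod p) : (64 : ℂ) *
        (if (χ x = 1 ∨ χ x = ζ) ∧ (-χ (g - x) = 1 ∨ -χ (g - x) = ζ) then 1 else 0) =
        ∑ i ∈ Icc 1 8, ∑ j ∈ Icc 1 8, (1 + (-ζ ^ 3) ^ i) * ((-1) ^ j * (1 + (-ζ ^ 3) ^ j)) *
          (χ x ^ i * χ (g - x) ^ j) := by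
      have e1 := sum_Icc_one_add_mul_pow_eq_ite hζ (hχ0 x)
      have e2 := sum_Icc_one_add_mul_pow_eq_ite hζ (w := -χ (g - x)) (by
        rw [neg_eq_zero, Even.neg_pow (by decide)]; exact hχ0 _)
      trans (∑ i ∈ Icc 1 8, (1 + (-ζ ^ 3) ^ i) * χ x ^ i) *
        ∑ j ∈ Icc 1 8, (1 + (-ζ ^ 3) ^ j) * (-χ (g - x)) ^ j
      · rw [e1, e2]
        by_cases q1 : χ x = 1 ∨ χ x = ζ <;> by_cases q2 : -χ (g - x) = 1 ∨ -χ (g - x) = ζ <;>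
          simp only [q1, q2, and_self, and_true, and_false, if_true, if_false] <;> norm_num
      · rw [Finset.sum_mul_sum]
        refine Finset.sum_congr rfl fun i _ ↦ Finset.sum_congr rfl fun j _ ↦ ?_
        rw [neg_pow (χ (g - x))]
        ring
    rw [Finset.card_filter, Nat.cast_sum, Finset.mul_sum]
    simp only [Nat.cast_ite, Nat.cast_one, Nat.cast_zero, hterm]
    rw [Finset.sum_comm]
    refine Finset.sum_congr rfl fun i hi ↦ ?_
    rw [Finset.sum_comm]
    refine Finset.sum_congr rfl fun j hj ↦ ?_
    rw [← Finset.mul_sum, sum_pow_mul_pow_sub_eq_jacobiSum χ hg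
      (by have := Finset.mem_Icc.mp hi; omega) (by have := Finset.mem_Icc.mp hj; omega)]
  have hp1 := (Fact.out : p.Prime).one_le
  rw [← Nat.cast_one, ← Nat.cast_sub hp1] at hcount
  have hnat : 64 * #{x | (χ x = 1 ∨ χ x = ζ) ∧ (-χ (g - x) = 1 ∨ -χ (g - x) = ζ)} =
      4 * (p - 1) := by
    exact_mod_cast hcount
  omega

theorem ncard_apply_eq {χ : MulChar (ZMod p) ℂ} (hord : orderOf χ = 8)
    (hχ : ∀ x ≠ 0, χ x ^ 8 = 1) {u : ℂ} (hu : u ^ 8 = 1) :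
    8 * {x | χ x = u}.ncard = p - 1 := by
  have hu0 : u ≠ 0 := by rintro rfl; norm_num at hu
  have h8 : χ ^ 8 = 1 := hord ▸ pow_orderOf_eq_one χ
  have hset : {x | χ x = u} = (univ.filter fun x ↦ χ x = u : Finset (ZMod p)) := by simp
  rw [hset, Set.ncard_coe_finset]
  have hterm (x : ZMod p) : (8 : ℂ) * (if χ x = u then 1 else 0) =
      ∑ j ∈ Icc 1 8, u⁻¹ ^ j * χ x ^ j := by
    simp only [← mul_pow]
    rw [sum_Icc_pow_eq_ite]
    · simp [inv_mul_eq_iff_eq_mul₀ hu0]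
    · rcases eq_or_ne x 0 with rfl | hx
      · left; rw [χ.map_zero, mul_zero]
      · right; rw [mul_pow, hχ x hx, inv_pow, hu]; norm_num
  have hcount : (8 : ℂ) * #{x | χ x = u} = ((p - 1 : ℕ) : ℂ) := by
    rw [Finset.card_filter, Nat.cast_sum, Finset.mul_sum]
    simp only [Nat.cast_ite, Nat.cast_one, Nat.cast_zero, hterm]
    rw [Finset.sum_comm, Finset.sum_eq_single 8]
    · rw [← Finset.mul_sum, inv_pow, hu, inv_one, one_mul]
      simp only [← MulChar.pow_apply' χ (show (8 : ℕ) ≠ 0 by norm_num), h8]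
      rw [MulChar.sum_one_eq_card_units, ZMod.card_units]
    · intro j hj hj8
      have hj' := Finset.mem_Icc.mp hj
      simp only [← MulChar.pow_apply' χ (show j ≠ 0 by omega)]
      rw [← Finset.mul_sum, MulChar.sum_eq_zero_of_ne_one, mul_zero]
      rw [ne_eq, ← orderOf_dvd_iff_pow_eq_one, hord]
      omega
    · intro h; exact absurd (Finset.mem_Icc.mpr (by norm_num)) h
  exact_mod_cast hcount

end

section

variable {p : ℕ} [Fact p.Prime]

theorem ofRootOfUnity_generator_properties {α : (ZMod p)ˣ}
    (hα : ∀ x : (ZMod p)ˣ, x ∈ Subgroup.zpowers α) (hp16 : p % 16 = 1) {ζ : ℂ}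
    (hζ : IsPrimitiveRoot ζ 8) {χ : MulChar (ZMod p) ℂ} (hχα : χ α = ζ) :
    orderOf χ = 8 ∧ (∀ x ≠ 0, χ x ^ 8 = 1) ∧ χ (-1) = 1 ∧
      (∀ t, (χ ^ 4) t = (quadraticChar (ZMod p) t : ℂ)) ∧
      ∀ i : ℤ, {x : ZMod p | ∃ v : ℤ, x = ((α ^ (8 * v + i) : (ZMod p)ˣ) : ZMod p)} =
        {x | χ x = ζ ^ i} := by
  have hp2 : p ≠ 2 := by rintro rfl; norm_num at hp16
  have hF : ringChar (ZMod p) ≠ 2 := by rwa [ZMod.ringChar_zmod_n]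
  have hζ0 : ζ ≠ 0 := hζ.ne_zero (by norm_num)
  have hzpow (m : ℤ) : χ ((α ^ m : (ZMod p)ˣ) : ZMod p) = ζ ^ m := by
    have h := congrArg (Units.val) (map_zpow χ.toUnitHom α m)
    rw [MulChar.coe_toUnitHom] at h
    rw [h, Units.val_zpow_eq_zpow_val, MulChar.coe_toUnitHom, hχα]
  have hval (x : ZMod p) (hx : x ≠ 0) : ∃ m : ℤ, x = ((α ^ m : (ZMod p)ˣ) : ZMod p) := by
    obtain ⟨m, hm⟩ := hα (Units.mk0 x hx)
    exact ⟨m, by simpa using (congrArg Units.val hm).symm⟩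
  refine ⟨?_, ?_, ?_, ?_, ?_⟩
  · rw [orderOf_eq_iff (by norm_num)]
    constructor
    · rw [MulChar.eq_iff hα, MulChar.pow_apply_coe, hχα, hζ.pow_eq_one, MulChar.one_apply_coe]
    · intro m hm hm0
      rw [ne_eq, MulChar.eq_iff hα, MulChar.pow_apply_coe, hχα, MulChar.one_apply_coe]
      exact hζ.pow_ne_one_of_pos_of_lt hm0.ne' hm
  · intro x hx
    obtain ⟨m, rfl⟩ := hval x hx
    rw [hzpow, ← zpow_natCast, ← zpow_mul, mul_comm, zpow_mul, zpow_natCast, hζ.pow_eq_one,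
      one_zpow]
  · obtain ⟨m, hm⟩ := hval (-1) (neg_ne_zero.mpr one_ne_zero)
    have hone : α ^ (2 * m) = 1 := by
      ext
      rw [mul_comm, zpow_mul, zpow_ofNat, Units.val_pow_eq_pow_val, ← hm]
      norm_num
    have hdvd := orderOf_dvd_iff_zpow_eq_one.mpr hone
    rw [orderOf_eq_card_of_forall_mem_zpowers hα, Nat.card_eq_fintype_card, ZMod.card_units] at hdvd
    have h16 : ((16 : ℕ) : ℤ) ∣ 2 * m :=
      (Int.natCast_dvd_natCast.mpr (by omega : 16 ∣ p - 1)).trans hdvd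
    rw [hm, hzpow, hζ.zpow_eq_one_iff_dvd]
    omega
  · have hα1 : quadraticChar (ZMod p) α = -1 := by
      refine (quadraticChar_dichotomy α.ne_zero).resolve_left fun h ↦ quadraticChar_ne_one hF ?_
      rw [MulChar.eq_iff hα, h, MulChar.one_apply_coe]
    have hζ4 : ζ ^ 4 = -1 := by
      have h1 : (ζ ^ 4) ^ 2 = 1 := by rw [← pow_mul]; exact hζ.pow_eq_one
      exact (sq_eq_one_iff.mp h1).resolve_left
        (hζ.pow_ne_one_of_pos_of_lt (by norm_num) (by norm_num))
    have : χ ^ 4 = (quadraticChar (ZMod p)).ringHomComp (Int.castRingHom ℂ) := by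
      rw [MulChar.eq_iff hα, MulChar.pow_apply_coe, hχα, MulChar.ringHomComp_apply, hα1, hζ4]
      simp
    intro t
    rw [this, MulChar.ringHomComp_apply]
    simp
  · intro i
    ext x
    simp only [Set.mem_ofPred_eq]
    constructor
    · rintro ⟨v, rfl⟩
      rw [hzpow, zpow_add₀ hζ0, zpow_mul, zpow_ofNat, hζ.pow_eq_one, one_zpow, one_mul]
    · intro h
      have hx : x ≠ 0 := by
        rintro rfl
        rw [χ.map_zero] at h
        exact (zpow_ne_zero i hζ0) h.symm
      obtain ⟨m, rfl⟩ := hval x hx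
      rw [hzpow] at h
      have h1 : ζ ^ (m - i) = 1 := by
        rw [zpow_sub₀ hζ0, h, div_self (zpow_ne_zero i hζ0)]
      obtain ⟨v, hv⟩ := (hζ.zpow_eq_one_iff_dvd _).mp h1
      exact ⟨v, by rw [← Nat.cast_ofNat (n := 8), ← hv]; simp⟩

open NumberTheorySymbols in
theorem apply_four_eq_neg_one_pow {n : ℕ} (hn : 1 ≤ n) (hp : p = 4 * n ^ 4 + 12 * n ^ 2 + 1)
    {χ : MulChar (ZMod p) ℂ} (hneg : χ (-1) = 1)
    (hρ : ∀ t, (χ ^ 4) t = (quadraticChar (ZMod p) t : ℂ)) : χ 4 = (-1) ^ n := by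
  have h1 : χ (2 * n) ^ 4 = 1 := by
    have h := hρ ((2 * n : ℤ) : ZMod p)
    have h' : legendreSym p (2 * n) = 1 := by
      rw [jacobiSym.legendreSym.to_jacobiSym]; exact jacobiSym_two_mul_eq_one hn hp
    rw [← legendreSym, h', MulChar.pow_apply' _ (by norm_num)] at h
    simpa using h
  have h2 : χ (2 * n ^ 2 + 1) ^ 4 = (-1) ^ n := by
    have h := hρ ((2 * n ^ 2 + 1 : ℤ) : ZMod p)
    have h' : legendreSym p (2 * n ^ 2 + 1) = (-1) ^ n := by
      rw [jacobiSym.legendreSym.to_jacobiSym]; exact jacobiSym_two_mul_sq_add_one hp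
    rw [← legendreSym, h', MulChar.pow_apply' _ (by norm_num)] at h
    simpa using h
  have h3 : (2 : ZMod p) * (2 * n) ^ 2 = -1 * (2 * n ^ 2 + 1) ^ 2 := by
    have h0 : ((4 * n ^ 4 + 12 * n ^ 2 + 1 : ℕ) : ZMod p) = 0 := by
      rw [← hp, ZMod.natCast_self]
    push_cast at h0
    linear_combination h0
  have h4 := congrArg χ h3
  rw [map_mul, map_pow, map_mul χ (-1), map_pow, hneg, one_mul] at h4
  have h5 : χ 4 = χ 2 ^ 2 := by rw [← map_pow]; norm_num
  rw [h5, ← h2]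
  linear_combination (χ 2 * χ (2 * n) ^ 2 + χ (2 * n ^ 2 + 1) ^ 2) * h4 - χ 2 ^ 2 * h1

theorem jacobiSum_pow_relations {χ : MulChar (ZMod p) ℂ} (hord : orderOf χ = 8)
    (hneg : χ (-1) = 1) (hp : p ≠ 2)
    (hρ : ∀ t, (χ ^ 4) t = (quadraticChar (ZMod p) t : ℂ)) (h4 : χ 4 ^ 2 = 1) {e : ℕ}
    (he : Odd e) :
    jacobiSum (χ ^ e) (χ ^ (3 * e)) = jacobiSum (χ ^ e) (χ ^ 4) ∧
    jacobiSum (χ ^ e) (χ ^ e) = χ 4 * jacobiSum (χ ^ e) (χ ^ 4) ∧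
    jacobiSum (χ ^ (2 * e)) (χ ^ (2 * e)) = jacobiSum (χ ^ (2 * e)) (χ ^ 4) ∧
    jacobiSum (χ ^ e) (χ ^ (5 * e)) = χ 4 * jacobiSum (χ ^ (2 * e)) (χ ^ 4) := by
  have he0 : e ≠ 0 := by rintro rfl; simp at he
  have hord' : orderOf (χ ^ e) = 8 := by
    rw [Nat.Coprime.orderOf_pow (by
      rw [hord, show 8 = 2 ^ 3 by rfl]
      exact Nat.Coprime.pow_left 3 (Nat.coprime_two_left.mpr he)), hord]
  have e4 : (χ ^ e) ^ 4 = χ ^ 4 := by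
    rw [← pow_mul, ← pow_mod_orderOf, hord]
    congr 1
    obtain ⟨k, rfl⟩ := he
    omega
  have hε : (χ ^ e) 4 = χ 4 := by
    obtain ⟨k, rfl⟩ := he
    rw [MulChar.pow_apply' _ he0, pow_succ, pow_mul, h4, one_pow, one_mul]
  have h := jacobiSum_relations hord'
    (by rw [MulChar.pow_apply' _ he0, hneg, one_pow]) hp (by rwa [e4]) (by rwa [hε])
  rw [e4, hε, ← pow_mul, ← pow_mul, ← pow_mul] at h
  simpa only [mul_comm e] using h

end

/-- Let `n ≥ 1` with `p = 4n⁴ + 12n² + 1` prime, `α` a generator of `(ℤ/pℤ)ˣ`, and `C i`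
the order-8 cyclotomic cosets. Then either both `(C 0 ∪ C 1, C 4 ∪ C 5)` and
`(C 0 ∪ C 7, C 3 ∪ C 4)`, or both `(C 0 ∪ C 5, C 1 ∪ C 4)` and `(C 0 ∪ C 3, C 4 ∪ C 7)`,
are `(p-1)/16`-fold near-factorizations of the additive group `ℤ/pℤ`; in each case all the
subsets involved have cardinality `(p-1)/4`. -/
theorem stmt_16 (n : ℕ) (hn : 1 ≤ n)
    (p : ℕ) (hp : p = 4 * n ^ 4 + 12 * n ^ 2 + 1) (hprime : p.Prime)
    (α : (ZMod p)ˣ) (hα : ∀ x : (ZMod p)ˣ, x ∈ Subgroup.zpowers α)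
    (C : ℤ → Set (ZMod p))
    (hC : ∀ i : ℤ, C i = {x : ZMod p | ∃ v : ℤ, x = ((α ^ (8 * v + i) : (ZMod p)ˣ) : ZMod p)})
    (NF : Set (ZMod p) → Set (ZMod p) → ℕ → Prop)
    (hNF : ∀ S T lam, NF S T lam ↔ ∀ g : ZMod p, g ≠ 0 →
      {st : ZMod p × ZMod p | st.1 ∈ S ∧ st.2 ∈ T ∧ st.1 + st.2 = g}.ncard = lam) :
    (NF (C 0 ∪ C 1) (C 4 ∪ C 5) ((p - 1) / 16) ∧ NF (C 0 ∪ C 7) (C 3 ∪ C 4) ((p - 1) / 16) ∧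
      (C 0 ∪ C 1).ncard = (p - 1) / 4 ∧ (C 4 ∪ C 5).ncard = (p - 1) / 4 ∧
      (C 0 ∪ C 7).ncard = (p - 1) / 4 ∧ (C 3 ∪ C 4).ncard = (p - 1) / 4) ∨
    (NF (C 0 ∪ C 5) (C 1 ∪ C 4) ((p - 1) / 16) ∧ NF (C 0 ∪ C 3) (C 4 ∪ C 7) ((p - 1) / 16) ∧
      (C 0 ∪ C 5).ncard = (p - 1) / 4 ∧ (C 1 ∪ C 4).ncard = (p - 1) / 4 ∧
      (C 0 ∪ C 3).ncard = (p - 1) / 4 ∧ (C 4 ∪ C 7).ncard = (p - 1) / 4) := by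
  have hfact : Fact p.Prime := ⟨hprime⟩
  have hp16 : p % 16 = 1 := by
    rcases Nat.even_or_odd' n with ⟨t, ht | ht⟩ <;> rw [ht] at hp <;> ring_nf at hp <;> omega
  have hp2 : p ≠ 2 := by rintro rfl; norm_num at hp16
  set ζ : ℂ := Complex.exp (2 * Real.pi * Complex.I / (8 : ℕ))
  have hζ : IsPrimitiveRoot ζ 8 := Complex.isPrimitiveRoot_exp 8 (by norm_num)
  have hζ0 : ζ ≠ 0 := hζ.ne_zero (by norm_num)
  have hζ4 : ζ ^ 4 = -1 := by
    have h1 : (ζ ^ 4) ^ 2 = 1 := by rw [← pow_mul]; exact hζ.pow_eq_one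
    exact (sq_eq_one_iff.mp h1).resolve_left (hζ.pow_ne_one_of_pos_of_lt (by norm_num) (by norm_num))
  have hmem : Units.mk0 ζ hζ0 ∈ rootsOfUnity (Fintype.card (ZMod p)ˣ) ℂ := by
    rw [mem_rootsOfUnity, ZMod.card_units]
    obtain ⟨k, hk⟩ : 8 ∣ p - 1 := by omega
    ext
    rw [hk, pow_mul]
    simp [hζ.pow_eq_one]
  obtain ⟨χ, hχα⟩ : ∃ χ : MulChar (ZMod p) ℂ, χ α = ζ :=
    ⟨MulChar.ofRootOfUnity hmem hα, MulChar.ofRootOfUnity_spec hmem hα⟩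
  obtain ⟨hord, hχ, hneg, hρ, hCχ⟩ := ofRootOfUnity_generator_properties hα hp16 hζ hχα
  have hχ0 (x : ZMod p) : χ x = 0 ∨ χ x ^ 8 = 1 := by
    rcases eq_or_ne x 0 with rfl | hx
    · exact .inl χ.map_zero
    · exact .inr (hχ x hx)
  have hε : χ 4 = (-1) ^ n := apply_four_eq_neg_one_pow hn hp hneg hρ
  have hε2 : χ 4 ^ 2 = 1 := by rw [hε, ← pow_mul, mul_comm, pow_mul]; norm_num
  obtain ⟨a, b, c, d, k2, k6, k1, k7, ha, hc, hbe, hde, hcd, hab⟩ :=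
    exists_int_jacobiSum_eq hord hζ hχ0 (by omega) hneg hρ hε2
  have hpp : Prime (p : ℤ) := Nat.prime_iff_prime_int.mp hprime
  have hpodd : Odd (p : ℤ) := by rw [Int.odd_iff]; omega
  obtain ⟨hc2, hd2⟩ := sq_eq_sq_of_add_mul_sq_eq_prime (x := 2 * n ^ 2 + 1) (y := 2 * n) hpp hpodd
    (by norm_num) hcd (by rw [hp]; push_cast; ring) hde (even_two_mul _)
  obtain ⟨ha2, hb2⟩ := sq_eq_sq_of_add_mul_sq_eq_prime (x := 2 * n ^ 2 - 1) (y := 2 * (2 * n)) hpp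
    hpodd (by norm_num) hab (by rw [hp]; push_cast; ring) hbe (even_two_mul _)
  have hac : (c : ℂ) + a = -2 * χ 4 := by
    rw [hε]
    have : c + a = -2 * (-1) ^ n := by
      rcases Nat.even_or_odd n with hpar | hpar
      · have h4n : (4 : ℤ) ∣ (n : ℤ) ^ 2 := by
          obtain ⟨t, rfl⟩ := hpar
          exact ⟨t ^ 2, by push_cast; ring⟩
        rw [hpar.neg_one_pow]
        rcases sq_eq_sq_iff_eq_or_eq_neg.mp hc2 with h | h <;>
          rcases sq_eq_sq_iff_eq_or_eq_neg.mp ha2 with h' | h' <;> omega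
      · have h4n : (4 : ℤ) ∣ (n : ℤ) ^ 2 - 1 := by
          obtain ⟨t, rfl⟩ := hpar
          exact ⟨t ^ 2 + t, by push_cast; ring⟩
        rw [hpar.neg_one_pow]
        rcases sq_eq_sq_iff_eq_or_eq_neg.mp hc2 with h | h <;>
          rcases sq_eq_sq_iff_eq_or_eq_neg.mp ha2 with h' | h' <;> omega
    exact_mod_cast this
  have hmod (i j : ℕ) (hij : i % 8 = j % 8) : χ ^ i = χ ^ j := by
    rw [← pow_mod_orderOf, hord, hij, ← hord, pow_mod_orderOf]
  have r1 := jacobiSum_pow_relations hord hneg hp2 hρ hε2 (e := 1) (by decide)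
  have r3 := jacobiSum_pow_relations hord hneg hp2 hρ hε2 (e := 3) (by decide)
  have r5 := jacobiSum_pow_relations hord hneg hp2 hρ hε2 (e := 5) (by decide)
  have r7 := jacobiSum_pow_relations hord hneg hp2 hρ hε2 (e := 7) (by decide)
  norm_num only [hmod 9 1 rfl, hmod 15 7 rfl, hmod 21 5 rfl] at r1 r3 r5 r7
  obtain ⟨s13, s11, s22, s15⟩ := r1
  obtain ⟨s31, s33, s66, s37⟩ := r3
  obtain ⟨s57, s55, -, -⟩ := r5
  obtain ⟨s75, s77, -, -⟩ := r7
  rw [jacobiSum_comm, s13] at s31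
  rw [jacobiSum_comm, s57] at s75
  have hmain (ζ' b' d' : ℂ) (h4 : ζ' ^ 4 = -1) (hb : b' * ζ' ^ 2 = b * ζ ^ 2)
      (hd : d' * (ζ' + ζ' ^ 3) = d * (ζ + ζ ^ 3)) (hbd : b' = 2 * d') (S T : Set (ZMod p))
      (hS : S = {x | χ x = 1 ∨ χ x = ζ'}) (hT : T = {x | χ x = ζ' ^ 4 ∨ χ x = ζ' ^ 5}) :
      NF S T ((p - 1) / 16) := by
    rw [hNF, hS, hT]
    intro g hg
    exact ncard_add_eq_of_jacobiSum hord hχ hneg h4 hε2 hbd hac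
      (by rw [s22, k2, hb]) (by rw [s66, k6, hb]) (by rw [s13, pow_one, k1, hd])
      (by rw [s57, s75, k7, hd]) (by rw [s11, s13]) (by rw [s33, ← s31, s13])
      (by rw [s55, s57]) (by rw [s77, s57, s75]) (by rw [s15, s22]) (by rw [s37, s66]) hg
  have hCi (i : ℤ) : C i = {x | χ x = ζ ^ i} := by rw [hC, hCχ]
  have hcard (i j : ℤ) (hij : ¬ (8 : ℤ) ∣ i - j) : (C i ∪ C j).ncard = (p - 1) / 4 := by
    have h8 (i : ℤ) : 8 * (C i).ncard = p - 1 := by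
      rw [hCi]
      exact ncard_apply_eq hord hχ (by
        rw [← zpow_natCast, ← zpow_mul, mul_comm, zpow_mul, zpow_natCast, hζ.pow_eq_one, one_zpow])
    rw [Set.ncard_union_eq _ (Set.toFinite _) (Set.toFinite _)]
    · have := h8 i
      have := h8 j
      omega
    · rw [Set.disjoint_left, hCi, hCi]
      intro x (hx : χ x = ζ ^ i) (hx' : χ x = ζ ^ j)
      refine hij ((hζ.zpow_eq_one_iff_dvd _).mp ?_)
      rw [zpow_sub₀ hζ0, ← hx, ← hx', div_self]
      rw [hx]
      exact zpow_ne_zero i hζ0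
  have hbd : (b - 2 * d) * (b + 2 * d) = 0 := by linear_combination hb2 - 4 * hd2
  have z5 : ζ ^ 5 = -ζ := by linear_combination ζ * hζ4
  have z7 : ζ ^ 7 = -ζ ^ 3 := by linear_combination ζ ^ 3 * hζ4
  have hunion (i j : ℕ) (u v : ℂ) (hu : ζ ^ i = u) (hv : ζ ^ j = v) :
      C i ∪ C j = {x | χ x = u ∨ χ x = v} := by
    rw [hCi, hCi, zpow_natCast, zpow_natCast, hu, hv]; rfl
  rcases mul_eq_zero.mp hbd with h | h
  · left
    have hb : (b : ℂ) = 2 * d := by exact_mod_cast sub_eq_zero.mp h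
    exact ⟨hmain ζ b d hζ4 rfl rfl hb _ _
        (hunion 0 1 _ _ (pow_zero _) (pow_one _)) (hunion 4 5 _ _ rfl rfl),
      hmain (-ζ ^ 3) (-b) (-d) (by grind) (by grind) (by grind) (by grind) _ _
        (hunion 0 7 _ _ (pow_zero _) z7)
        ((Set.union_comm _ _).trans (hunion 4 3 _ _ (by grind) (by grind))),
      hcard _ _ (by norm_num), hcard _ _ (by norm_num), hcard _ _ (by norm_num),
      hcard _ _ (by norm_num)⟩
  · right
    have hb : (b : ℂ) = -2 * d := by
      have : b = -2 * d := by linarith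
      exact_mod_cast this
    exact ⟨hmain (-ζ) b (-d) (by grind) (by grind) (by grind) (by grind) _ _
        (hunion 0 5 _ _ (pow_zero _) z5)
        ((Set.union_comm _ _).trans (hunion 4 1 _ _ (by grind) (by grind))),
      hmain (ζ ^ 3) (-b) d (by grind) (by grind) (by grind) (by grind) _ _
        (hunion 0 3 _ _ (pow_zero _) rfl) (hunion 4 7 _ _ (by grind) (by grind)),
      hcard _ _ (by norm_num), hcard _ _ (by norm_num), hcard _ _ (by norm_num),
      hcard _ _ (by norm_num)⟩
end

section
/- Let n ≥ 1 be an integer such that p = 4n⁴ + 12n² + 1 is prime. Then there exist subsets S and T of ℤ/pℤ with |S| = |T| = (p−1)/4 such that (S, T) is a ((p−1)/16)-fold near-factorization of the additive group ℤ/pℤ. -/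
/-- Associativity of Jacobi sums: both sides equal `g(α) g(β) g(γ) / g(αβγ)`. -/
lemma jacobiSum_mul_jacobiSum_assoc {p : ℕ} [Fact p.Prime] {α β γ : MulChar (ZMod p) ℂ}
    (hαβ : α * β ≠ 1) (hβγ : β * γ ≠ 1) (hαβγ : α * β * γ ≠ 1) :
    jacobiSum α β * jacobiSum (α * β) γ = jacobiSum α (β * γ) * jacobiSum β γ := by
  have hp : (Fintype.card (ZMod p) : ℂ) ≠ 0 := by
    rw [ZMod.card]; exact_mod_cast (Fact.out : p.Prime).ne_zero
  let ψ : AddChar (ZMod p) ℂ := ZMod.stdAddChar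
  have hG := gaussSum_ne_zero_of_nontrivial hp hαβγ (ZMod.isPrimitive_stdAddChar p)
  have h1 := jacobiSum_mul_nontrivial hαβ ψ
  have h2 := jacobiSum_mul_nontrivial hβγ ψ
  have h3 := jacobiSum_mul_nontrivial hαβγ ψ
  have h4 := jacobiSum_mul_nontrivial (mul_assoc α β γ ▸ hαβγ) ψ
  rw [← mul_assoc] at h4
  refine mul_left_cancel₀ hG ?_
  linear_combination jacobiSum α β * h3 + gaussSum γ ψ * h1 - jacobiSum β γ * h4
    - gaussSum α ψ * h2

lemma jacobiSum_eq_jacobiSum_inv_mul {F R : Type*} [Field F] [Fintype F] [Field R]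
    (α β : MulChar F R) : jacobiSum α β = α (-1) * jacobiSum α (α * β)⁻¹ := by
  classical
  rw [jacobiSum_eq_sum_sdiff, jacobiSum, Finset.mul_sum,
    ← Finset.sum_subset (Finset.subset_univ (Finset.univ \ {0, 1}))]
  · refine Finset.sum_nbij' (fun x ↦ x / (x - 1)) (fun x ↦ x / (x - 1)) ?_ ?_ ?_ ?_ ?_
    · intro x hx
      simp only [Finset.mem_sdiff, Finset.mem_univ, Finset.mem_insert, Finset.mem_singleton,
        not_or, true_and] at hx ⊢
      have h1 : x - 1 ≠ 0 := sub_ne_zero.mpr hx.2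
      refine ⟨div_ne_zero hx.1 h1, fun h ↦ ?_⟩
      rw [div_eq_one_iff_eq h1] at h
      exact one_ne_zero (α := F) (by linear_combination h)
    · intro x hx
      simp only [Finset.mem_sdiff, Finset.mem_univ, Finset.mem_insert, Finset.mem_singleton,
        not_or, true_and] at hx ⊢
      have h1 : x - 1 ≠ 0 := sub_ne_zero.mpr hx.2
      refine ⟨div_ne_zero hx.1 h1, fun h ↦ ?_⟩
      rw [div_eq_one_iff_eq h1] at h
      exact one_ne_zero (α := F) (by linear_combination h)
    · intro x hx
      simp only [Finset.mem_sdiff, Finset.mem_univ, Finset.mem_insert, Finset.mem_singleton,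
        not_or, true_and] at hx
      have h1 : x - 1 ≠ 0 := sub_ne_zero.mpr hx.2
      have e : x / (x - 1) - 1 = (x - 1)⁻¹ := by field_simp; ring
      rw [e, div_inv_eq_mul, div_mul_cancel₀ _ h1]
    · intro x hx
      simp only [Finset.mem_sdiff, Finset.mem_univ, Finset.mem_insert, Finset.mem_singleton,
        not_or, true_and] at hx
      have h1 : x - 1 ≠ 0 := sub_ne_zero.mpr hx.2
      have e : x / (x - 1) - 1 = (x - 1)⁻¹ := by field_simp; ring
      rw [e, div_inv_eq_mul, div_mul_cancel₀ _ h1]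
    · intro x hx
      simp only [Finset.mem_sdiff, Finset.mem_univ, Finset.mem_insert, Finset.mem_singleton,
        not_or, true_and] at hx
      have h1 : x - 1 ≠ 0 := sub_ne_zero.mpr hx.2
      have e : 1 - x / (x - 1) = (1 - x)⁻¹ := by
        have : 1 - x ≠ 0 := sub_ne_zero.mpr (Ne.symm hx.2)
        field_simp
        ring
      have e2 : x = (-1) * (x / (x - 1)) * (1 - x) := by field_simp; ring
      rw [e, MulChar.inv_apply', inv_inv, MulChar.mul_apply]
      conv_lhs => rw [e2]
      simp only [map_mul]
      rw [← e2]
      ring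
  · intro x _ hx
    have : x = 0 ∨ x = 1 := by
      by_contra h
      exact hx (by simpa using h)
    rcases this with rfl | rfl <;> simp [MulChar.map_zero]

/-- The case `m = 2` of the Hasse–Davenport product relation, in terms of Jacobi sums. -/
lemma apply_four_mul_jacobiSum_self_s17 {F R : Type*} [Field F] [Fintype F] [DecidableEq F]
    [CommRing R] [IsDomain R] (hF : ringChar F ≠ 2) {α : MulChar F R} (hα : α ≠ 1) :
    α 4 * jacobiSum α α = jacobiSum α ((quadraticChar F).ringHomComp (Int.castRingHom R)) := by
  have h2 : (2 : F) ≠ 0 := Ring.two_ne_zero hF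
  calc α 4 * jacobiSum α α = ∑ x, α (1 - (2 * x - 1) ^ 2) := by
        rw [jacobiSum, Finset.mul_sum]
        refine Finset.sum_congr rfl fun x _ ↦ ?_
        rw [← map_mul, ← map_mul]
        congr 1; ring
    _ = ∑ y, α (1 - y ^ 2) := by
        refine Fintype.sum_bijective (fun x : F ↦ 2 * x - 1) ?_ _ _ fun x ↦ rfl
        refine (Finite.injective_iff_bijective).mp fun x y h ↦ ?_
        exact mul_left_cancel₀ h2 (sub_left_injective h)
    _ = ∑ v, ∑ y with y ^ 2 = v, α (1 - y ^ 2) := (Finset.sum_fiberwise _ _ _).symm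
    _ = ∑ v, ((quadraticChar F v + 1 : ℤ) : R) * α (1 - v) := by
        refine Finset.sum_congr rfl fun v _ ↦ ?_
        rw [← quadraticChar_card_sqrts hF v, Finset.sum_congr rfl (g := fun _ ↦ α (1 - v))
          (fun y hy ↦ by rw [(Finset.mem_filter.mp hy).2]), Finset.sum_const, nsmul_eq_mul]
        congr 1
        norm_cast
        simp
    _ = _ := by
        have : ∑ v, α (1 - v) = 0 := by
          rw [← MulChar.sum_eq_zero_of_ne_one hα]
          exact (Equiv.subLeft (1 : F)).sum_comp α
        simp only [Int.cast_add, Int.cast_one, add_mul, one_mul, Finset.sum_add_distrib, this,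
          add_zero]
        rw [jacobiSum_comm]
        rfl

lemma eq_quadraticChar_of_sq_eq_one {F R : Type*} [Field F] [Fintype F] [DecidableEq F]
    [CommRing R] [IsDomain R] [CharZero R] (hF : ringChar F ≠ 2) {φ : MulChar F R}
    (h1 : φ ≠ 1) (h2 : φ ^ 2 = 1) :
    φ = (quadraticChar F).ringHomComp (Int.castRingHom R) := by
  obtain ⟨g, hg⟩ := IsCyclic.exists_generator (α := Fˣ)
  have key (χ : MulChar F R) (h1 : χ ≠ 1) (h2 : χ ^ 2 = 1) : χ g = -1 := by
    have : χ g ^ 2 = 1 := by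
      rw [← MulChar.pow_apply' _ two_ne_zero, h2, MulChar.one_apply_coe]
    rw [sq] at this
    refine (mul_self_eq_one_iff.mp this).resolve_left fun h ↦ h1 ?_
    rw [MulChar.eq_iff hg, h, MulChar.one_apply_coe]
  rw [MulChar.eq_iff hg, key φ h1 h2, key]
  · rw [MulChar.ringHomComp_ne_one_iff (Int.cast_injective)]
    exact quadraticChar_ne_one hF
  · exact ((quadraticChar_isQuadratic F).comp _).sq_eq_one

/-- The form `x² + d y²` represents a prime essentially uniquely. -/
lemma sq_eq_sq_of_add_mul_sq_eq_prime_s17 {q d x y z w : ℤ} (hq : Prime q) (hq0 : 0 < q)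
    (hd : 1 ≤ d) (h1 : x ^ 2 + d * y ^ 2 = q) (h2 : z ^ 2 + d * w ^ 2 = q) :
    y ^ 2 = w ^ 2 ∨ (d = 1 ∧ y ^ 2 = z ^ 2) := by
  have main : ∀ y w : ℤ, x ^ 2 + d * y ^ 2 = q → z ^ 2 + d * w ^ 2 = q → q ∣ x * w - z * y →
      y ^ 2 = w ^ 2 ∨ (d = 1 ∧ y ^ 2 = z ^ 2) := by
    intro y w h1 h2 hdvd
    have e1 : (x * z + d * y * w) ^ 2 + d * (x * w - z * y) ^ 2 = q ^ 2 := by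
      rw [sq q]; nth_rw 1 [← h1]; rw [← h2]; ring
    obtain ⟨k, hk⟩ := hdvd
    rw [hk] at e1
    rcases eq_or_ne k 0 with rfl | hk0
    · left
      have e2 : q * (w ^ 2 - y ^ 2) = (x * w - z * y) * (x * w + z * y) := by
        linear_combination y ^ 2 * h2 - w ^ 2 * h1
      rw [hk] at e2
      have : w ^ 2 - y ^ 2 = 0 := by
        have := hq0.ne'
        simpa [this] using e2
      linarith
    · right
      have hk1 : 1 ≤ k ^ 2 := by
        have := sq_nonneg k
        have : k ^ 2 ≠ 0 := pow_ne_zero 2 hk0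
        omega
      have hq2 : 0 < q ^ 2 := by positivity
      have hle : d * k ^ 2 ≤ 1 := by
        by_contra! h
        nlinarith [sq_nonneg (x * z + d * y * w)]
      have hd1 : d = 1 := by nlinarith
      subst hd1
      refine ⟨rfl, ?_⟩
      have hk2 : k ^ 2 = 1 := by linarith
      have e3 : x * z + 1 * y * w = 0 := by
        rw [mul_pow, hk2] at e1
        exact pow_eq_zero_iff two_ne_zero |>.mp (by linarith)
      have e4 : q * (y ^ 2 + w ^ 2 - q) = 0 := by
        have e5 : x ^ 2 * z ^ 2 = y ^ 2 * w ^ 2 := by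
          have : x * z = -(y * w) := by linarith
          rw [← mul_pow, this]; ring
        rw [show x ^ 2 = q - y ^ 2 by linarith, show z ^ 2 = q - w ^ 2 by linarith] at e5
        linarith
      have := (mul_eq_zero.mp e4).resolve_left hq0.ne'
      linarith
  have hprod : q ∣ (x * w - z * y) * (x * w + z * y) := by
    refine ⟨w ^ 2 - y ^ 2, ?_⟩
    linear_combination w ^ 2 * h1 - y ^ 2 * h2
  rcases hq.dvd_or_dvd hprod with h | h
  · exact main y w h1 h2 h
  · have := main (-y) w (by rwa [neg_sq]) h2 (by rwa [mul_neg, sub_neg_eq_add])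
    rwa [neg_sq] at this

section OcticCharacter

variable {p : ℕ} [Fact p.Prime] {χ : MulChar (ZMod p) ℂ}

lemma four_pow_mul_jacobiSum_pow (hp : p ≠ 2) (hχ : orderOf χ = 8) {j : ℕ} (hj : ¬ 8 ∣ j) :
    χ 4 ^ j * jacobiSum (χ ^ j) (χ ^ j) = jacobiSum (χ ^ j) (χ ^ 4) := by
  have hF : ringChar (ZMod p) ≠ 2 := by rwa [ZMod.ringChar_zmod_n]
  have h4 : χ ^ 4 = _ := eq_quadraticChar_of_sq_eq_one (R := ℂ) hF
    (φ := χ ^ 4) (pow_ne_one_of_lt_orderOf (by norm_num) (by omega))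
    (by rw [← pow_mul]; exact orderOf_dvd_iff_pow_eq_one.mp (by rw [hχ]))
  have hj' : χ ^ j ≠ 1 := fun h ↦ hj (hχ ▸ orderOf_dvd_of_pow_eq_one h)
  rw [h4, ← apply_four_mul_jacobiSum_self_s17 hF hj',
    MulChar.pow_apply' _ (by rintro rfl; simp at hj)]

lemma octic_jacobiSum_one_four (hχ : orderOf χ = 8) (h1 : χ (-1) = 1) :
    jacobiSum χ (χ ^ 4) = jacobiSum χ (χ ^ 3) := by
  have h8 : χ ^ 8 = 1 := hχ ▸ pow_orderOf_eq_one χ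
  rw [jacobiSum_eq_jacobiSum_inv_mul, h1, one_mul]
  congr 1
  rw [inv_eq_iff_mul_eq_one, ← pow_succ', ← pow_add, h8]

lemma octic_jacobiSum_one_three (hp : p ≠ 2) (hχ : orderOf χ = 8) (h1 : χ (-1) = 1) :
    jacobiSum χ (χ ^ 3) = χ 4 * jacobiSum χ χ := by
  have := four_pow_mul_jacobiSum_pow hp hχ (j := 1) (by norm_num)
  rw [pow_one, pow_one] at this
  rw [this, octic_jacobiSum_one_four hχ h1]

lemma octic_jacobiSum_three_three (hp : p ≠ 2) (hχ : orderOf χ = 8) (h1 : χ (-1) = 1)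
    (h4 : χ 4 ^ 2 = 1) : jacobiSum (χ ^ 3) (χ ^ 3) = jacobiSum χ χ := by
  have h8 : χ ^ 8 = 1 := hχ ▸ pow_orderOf_eq_one χ
  have h30 := octic_jacobiSum_one_three hp hχ h1
  have h31 := four_pow_mul_jacobiSum_pow hp hχ (j := 3) (by norm_num)
  have h3 : jacobiSum (χ ^ 3) (χ ^ 4) = jacobiSum (χ ^ 3) χ := by
    rw [jacobiSum_eq_jacobiSum_inv_mul, MulChar.pow_apply' _ (by norm_num), h1, one_pow, one_mul]
    congr 1
    rw [inv_eq_iff_mul_eq_one, ← pow_add, ← pow_succ, h8]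
  rw [h3, jacobiSum_comm (χ ^ 3) χ, h30] at h31
  linear_combination χ 4 * h31 + (jacobiSum χ χ - (χ 4 ^ 2 + 1) * jacobiSum (χ ^ 3) (χ ^ 3)) * h4

lemma jacobiSum_mul_jacobiSum_inv_eq_prime (hχ : χ ≠ 1) (hχ2 : χ * χ ≠ 1) :
    jacobiSum χ χ * jacobiSum χ⁻¹ χ⁻¹ = p := by
  rw [jacobiSum_mul_jacobiSum_inv _ hχ hχ hχ2, ZMod.card]
  rw [ZMod.ringChar_zmod_n, ringChar.eq_zero]
  exact (Fact.out : p.Prime).ne_zero.symm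

lemma octic_jacobiSum_one_five (hp : p ≠ 2) (hχ : orderOf χ = 8) (h4 : χ 4 ^ 2 = 1) :
    jacobiSum χ (χ ^ 5) = χ 4 * jacobiSum (χ ^ 2) (χ ^ 2) := by
  have hne {j : ℕ} (hj : ¬ 8 ∣ j) : χ ^ j ≠ 1 := fun h ↦ hj (hχ ▸ orderOf_dvd_of_pow_eq_one h)
  have e1 := four_pow_mul_jacobiSum_pow hp hχ (j := 1) (by norm_num)
  have e2 := four_pow_mul_jacobiSum_pow hp hχ (j := 2) (by norm_num)
  have hA := jacobiSum_mul_jacobiSum_inv_eq_prime (χ := χ)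
    (by simpa using hne (j := 1) (by norm_num)) (by simpa [sq] using hne (j := 2) (by norm_num))
  have hA0 : jacobiSum χ χ ≠ 0 := by
    intro h
    rw [h, zero_mul] at hA
    exact (Fact.out : p.Prime).ne_zero (by exact_mod_cast hA.symm)
  have h0 : χ 4 ≠ 0 := by intro h; simp [h] at h4
  have key := jacobiSum_mul_jacobiSum_assoc (α := χ) (β := χ) (γ := χ ^ 4)
    (by rw [← sq]; exact hne (by norm_num)) (by rw [← pow_succ']; exact hne (by norm_num))
    (by rw [← sq, ← pow_add]; exact hne (by norm_num))
  rw [← sq, ← pow_succ', ← e2, h4, one_mul] at key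
  rw [pow_one, pow_one] at e1
  rw [← e1] at key
  have : jacobiSum (χ ^ 2) (χ ^ 2) = jacobiSum χ (χ ^ 5) * χ 4 :=
    mul_left_cancel₀ hA0 (by linear_combination key)
  rw [this]
  linear_combination -jacobiSum χ (χ ^ 5) * h4

/-- The number of `x` for which `x (1 - x)` lies in the `k`-th octic class. -/
noncomputable def octicCount (χ : MulChar (ZMod p) ℂ) (ω : ℂ) (k : ℕ) : ℕ :=
  {x : ZMod p | χ (x * (1 - x)) = ω ^ k}.ncard

lemma octicCount_eq_card (ω : ℂ) (k : ℕ) [DecidableEq ℂ] :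
    octicCount χ ω k = (Finset.univ.filter fun x : ZMod p ↦ χ (x * (1 - x)) = ω ^ k).card := by
  rw [octicCount, Set.ncard_eq_toFinset_card']
  congr 1
  ext; simp

lemma jacobiSum_pow_self_eq_sum_octicCount (hχ : orderOf χ = 8) {ω : ℂ}
    (hω : IsPrimitiveRoot ω 8) {j : ℕ} (hj : j ≠ 0) :
    jacobiSum (χ ^ j) (χ ^ j) = ∑ k ∈ Finset.range 8, (octicCount χ ω k : ℂ) * (ω ^ k) ^ j := by
  classical
  have h8 : χ ^ 8 = 1 := hχ ▸ pow_orderOf_eq_one χ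
  have step (z : ZMod p) : χ z ^ j =
      ∑ k ∈ Finset.range 8, if χ z = ω ^ k then (ω ^ k) ^ j else 0 := by
    rcases eq_or_ne z 0 with rfl | hz
    · rw [MulChar.map_zero, zero_pow hj, Finset.sum_eq_zero]
      intro k _
      rw [if_neg]
      exact (pow_ne_zero k (hω.ne_zero (by norm_num))).symm
    · obtain ⟨k, hk, hk'⟩ := MulChar.exists_apply_eq_pow h8 hω hz
      rw [Finset.sum_eq_single k, if_pos hk', hk']
      · intro l hl hlk
        rw [if_neg]
        rw [hk']
        exact fun h ↦ hlk (hω.pow_inj (Finset.mem_range.mp hl) hk h.symm)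
      · simp [hk]
  simp only [jacobiSum, MulChar.pow_apply' _ hj, ← mul_pow, ← map_mul]
  simp only [step]
  rw [Finset.sum_comm]
  refine Finset.sum_congr rfl fun k _ ↦ ?_
  rw [octicCount_eq_card, ← Finset.sum_filter, Finset.sum_const, nsmul_eq_mul]

lemma even_octicCount (hp : p ≠ 2) {ω : ℂ} {k : ℕ} (h : χ 4 * ω ^ k ≠ 1) :
    Even (octicCount χ ω k) := by
  classical
  have h2 : (2 : ZMod p) ≠ 0 := Ring.two_ne_zero (by rwa [ZMod.ringChar_zmod_n])
  rw [octicCount_eq_card, ← ZMod.natCast_eq_zero_iff_even, Finset.cast_card]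
  refine Finset.sum_involution (fun x _ ↦ 1 - x) (fun _ _ ↦ by decide) ?_ ?_ ?_
  · intro x hx _ hfix
    have hx2 : 4 * (x * (1 - x)) = 1 := by linear_combination (2 * x - 1) * hfix
    apply h
    rw [← (Finset.mem_filter.mp hx).2, ← map_mul, hx2, map_one]
  · intro x hx
    simpa [mul_comm] using hx
  · simp

end OcticCharacter

section OcticJacobiSums

variable {p : ℕ} [Fact p.Prime] {χ : MulChar (ZMod p) ℂ}

lemma pow_four_eq_neg_one_of_primitiveRoot {R : Type*} [CommRing R] [IsDomain R] {ω : R}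
    (hω : IsPrimitiveRoot ω 8) : ω ^ 4 = -1 := by
  have h : (ω ^ 4 - 1) * (ω ^ 4 + 1) = 0 := by linear_combination hω.pow_eq_one
  refine eq_neg_of_add_eq_zero_left ((mul_eq_zero.mp h).resolve_left ?_)
  exact sub_ne_zero.mpr (hω.pow_ne_one_of_pos_of_lt (by norm_num) (by norm_num))

lemma octic_pow_eq_one (hχ : orderOf χ = 8) {x : ZMod p} (hx : x ≠ 0) : χ x ^ 8 = 1 := by
  rw [← MulChar.pow_apply' _ (by norm_num), orderOf_dvd_iff_pow_eq_one.mp hχ.dvd,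
    MulChar.one_apply hx.isUnit]

lemma octic_apply_four {n : ℕ} (hp : p = 4 * n ^ 4 + 12 * n ^ 2 + 1) (hχ : orderOf χ = 8)
    (hp2 : p ≠ 2) : χ 4 = (-1) ^ n := by
  have hF : ringChar (ZMod p) ≠ 2 := by rwa [ZMod.ringChar_zmod_n]
  set m : ℕ := 2 * n ^ 2 + 3 with hm
  have hodd : Odd m := ⟨n ^ 2 + 1, by rw [hm]; ring⟩
  have hpm : (p : ℤ) = (m : ℤ) ^ 2 - 8 := by rw [hp, hm]; push_cast; ring
  have hm8 : (m : ZMod p) ^ 2 = 8 := by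
    have := congrArg (Int.cast : ℤ → ZMod p) hpm
    push_cast at this
    rw [ZMod.natCast_self] at this
    linear_combination -this
  have h2 : (2 : ZMod p) ≠ 0 := Ring.two_ne_zero hF
  have hm0 : (m : ZMod p) ≠ 0 := by
    intro h
    rw [h] at hm8
    exact pow_ne_zero 3 h2 (by linear_combination -hm8)
  have e1 : χ 2 ^ 3 = χ m ^ 2 := by
    rw [← map_pow, ← map_pow, hm8]; congr 1; norm_num
  have e2 : χ 2 ^ 4 = 1 := by
    have e3 := octic_pow_eq_one hχ hm0
    have e4 := octic_pow_eq_one hχ h2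
    have : χ 2 ^ 12 = 1 := by
      rw [← e3]
      linear_combination (χ 2 ^ 9 + χ 2 ^ 6 * χ m ^ 2 + χ 2 ^ 3 * χ m ^ 4 + χ m ^ 6) * e1
    linear_combination this - χ 2 ^ 4 * e4
  have e3 : χ 4 = χ m ^ 4 := by
    rw [show (4 : ZMod p) = 2 ^ 2 by norm_num, map_pow]
    linear_combination (χ 2 ^ 3 + χ m ^ 2) * e1 - χ 2 ^ 2 * e2
  have hφ : χ ^ 4 = _ := eq_quadraticChar_of_sq_eq_one (R := ℂ) hF
    (φ := χ ^ 4) (pow_ne_one_of_lt_orderOf (by norm_num) (by omega))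
    (by rw [← pow_mul]; exact orderOf_dvd_iff_pow_eq_one.mp (by rw [hχ]))
  have hgcd : Int.gcd 2 m = 1 := by
    rw [← Nat.cast_ofNat, Int.gcd_natCast_natCast]
    exact hodd.coprime_two_left
  have hleg : legendreSym p m = (-1) ^ n := by
    rw [jacobiSym.legendreSym.to_jacobiSym,
      ← jacobiSym.quadratic_reciprocity_one_mod_four (by omega) hodd, jacobiSym.mod_left,
      show (p : ℤ) % m = -8 % m from
        Int.ModEq.eq (Int.modEq_iff_dvd.mpr ⟨-m, by rw [hpm]; ring⟩), ← jacobiSym.mod_left,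
      show (-8 : ℤ) = -2 * 2 ^ 2 by norm_num, jacobiSym.mul_left, jacobiSym.sq_one' hgcd, mul_one,
      jacobiSym.at_neg_two hodd, ZMod.χ₈'_nat_eq_if_mod_eight]
    rcases Nat.even_or_odd' n with ⟨k, rfl | rfl⟩
    · rw [pow_mul, neg_one_sq, one_pow]
      ring_nf at hm
      rw [if_neg (by omega), if_pos (by omega)]
    · rw [pow_succ, pow_mul, neg_one_sq, one_pow]
      ring_nf at hm
      have : Even (k + k ^ 2) := by rw [add_comm, sq]; exact Nat.even_mul_succ_self k
      obtain ⟨l, hl⟩ := this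
      rw [if_neg (by omega), if_neg (by omega)]
      norm_num
  rw [e3, ← MulChar.pow_apply' _ (by norm_num), hφ, MulChar.ringHomComp_apply]
  have : quadraticChar (ZMod p) (m : ZMod p) = (-1) ^ n := by
    rw [← hleg, legendreSym]; push_cast; rfl
  rw [this]; simp

lemma octicCount_constraints {n s t u v e : ℤ} {M : ℕ → ℤ}
    (he : (e = 1 ∧ Even n) ∨ (e = -1 ∧ Odd n))
    (hprime : Prime (4 * n ^ 4 + 12 * n ^ 2 + 1))
    (hsum : M 0 + M 1 + M 2 + M 3 + M 4 + M 5 + M 6 + M 7 = 4 * n ^ 4 + 12 * n ^ 2 - 1)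
    (h26 : M 2 = M 6) (h13 : M 1 - M 5 = M 3 - M 7)
    (hs : s = M 0 + M 4 - M 2 - M 6) (ht : t = M 1 + M 5 - M 3 - M 7)
    (hu : u = M 0 - M 4) (hv : v = M 1 - M 5)
    (hst : s ^ 2 + t ^ 2 = 4 * n ^ 4 + 12 * n ^ 2 + 1)
    (huv : u ^ 2 + 2 * v ^ 2 = 4 * n ^ 4 + 12 * n ^ 2 + 1)
    (h0 : e = -1 → Even (M 0)) (h4 : e = 1 → Even (M 4)) (h1 : Even (M 1)) (h2 : Even (M 2))
    (h3 : Even (M 3)) (h5 : Even (M 5)) (h7 : Even (M 7)) :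
    e * u + s = -2 * e ∧ (t = 2 * (e * v) ∨ t = -(2 * (e * v))) := by
  have hpos : 0 < 4 * n ^ 4 + 12 * n ^ 2 + 1 := by positivity
  have hv2 : v ^ 2 = (2 * n) ^ 2 :=
    (sq_eq_sq_of_add_mul_sq_eq_prime_s17 hprime hpos one_le_two huv
      (z := 2 * n ^ 2 + 1) (by ring)).resolve_right (by simp)
  have ht2 : t ^ 2 = (4 * n) ^ 2 := by
    rcases sq_eq_sq_of_add_mul_sq_eq_prime_s17 hprime hpos le_rfl
      (by rwa [one_mul]) (z := 2 * n ^ 2 - 1) (w := 4 * n) (by ring) with h | ⟨-, h⟩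
    · exact h
    · have hte : Even t := by
        rw [ht]
        exact ((h1.add h5).sub h3).sub h7
      have : Even ((2 * n ^ 2 - 1) ^ 2) := h ▸ hte.pow_of_ne_zero two_ne_zero
      rw [Int.even_pow' two_ne_zero] at this
      obtain ⟨k, hk⟩ := this
      omega
  have hs2 : s = 2 * n ^ 2 - 1 ∨ s = -(2 * n ^ 2 - 1) := by
    rw [← sq_eq_sq_iff_eq_or_eq_neg]; linarith
  have hu2 : u = 2 * n ^ 2 + 1 ∨ u = -(2 * n ^ 2 + 1) := by
    rw [← sq_eq_sq_iff_eq_or_eq_neg]; linarith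
  constructor
  · have ht4 : (4 : ℤ) ∣ t := by
      rcases sq_eq_sq_iff_eq_or_eq_neg.mp ht2 with h | h <;> omega
    have hn4 : (4 : ℤ) ∣ 4 * n ^ 4 + 12 * n ^ 2 := ⟨n ^ 4 + 3 * n ^ 2, by ring⟩
    obtain ⟨k2, hk2⟩ := h2
    obtain ⟨k3, hk3⟩ := h3
    obtain ⟨k7, hk7⟩ := h7
    rcases he with ⟨rfl, k, hk⟩ | ⟨rfl, k, hk⟩
    · obtain ⟨k4, hk4⟩ := h4 rfl
      have hn2 : n ^ 2 = 4 * k ^ 2 := by rw [hk]; ring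
      omega
    · obtain ⟨k0, hk0⟩ := h0 rfl
      have hn2 : n ^ 2 = 4 * (k ^ 2 + k) + 1 := by rw [hk]; ring
      omega
  · rw [← sq_eq_sq_iff_eq_or_eq_neg]
    have he2 : e ^ 2 = 1 := by rcases he with ⟨rfl, -⟩ | ⟨rfl, -⟩ <;> norm_num
    linear_combination ht2 - 4 * hv2 - 4 * v ^ 2 * he2

lemma exists_octic_jacobiSums {n : ℕ} (hn : 1 ≤ n) (hp : p = 4 * n ^ 4 + 12 * n ^ 2 + 1) :
    ∃ (χ : MulChar (ZMod p) ℂ) (ω : ℂ) (s t a b e : ℤ), orderOf χ = 8 ∧ IsPrimitiveRoot ω 8 ∧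
      χ (-1) = 1 ∧ e ^ 2 = 1 ∧ t = 2 * b ∧ a + s = -2 * e ∧
      jacobiSum χ χ = e * (a + b * (ω + ω ^ 3)) ∧
      jacobiSum (χ ^ 3) (χ ^ 3) = e * (a + b * (ω + ω ^ 3)) ∧
      jacobiSum (χ ^ 5) (χ ^ 5) = e * (a - b * (ω + ω ^ 3)) ∧
      jacobiSum (χ ^ 7) (χ ^ 7) = e * (a - b * (ω + ω ^ 3)) ∧
      jacobiSum χ (χ ^ 3) = a + b * (ω + ω ^ 3) ∧
      jacobiSum (χ ^ 5) (χ ^ 7) = a - b * (ω + ω ^ 3) ∧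
      jacobiSum (χ ^ 2) (χ ^ 2) = s + t * ω ^ 2 ∧
      jacobiSum (χ ^ 6) (χ ^ 6) = s - t * ω ^ 2 ∧
      jacobiSum χ (χ ^ 5) = e * (s + t * ω ^ 2) ∧
      jacobiSum (χ ^ 3) (χ ^ 7) = e * (s - t * ω ^ 2) := by
  have h16 : 16 ∣ Fintype.card (ZMod p) - 1 := by
    rw [ZMod.card, hp, Nat.add_sub_cancel]
    rcases Nat.even_or_odd' n with ⟨k, rfl | rfl⟩
    · exact ⟨4 * k ^ 4 + 3 * k ^ 2, by ring⟩
    · exact ⟨4 * k ^ 4 + 8 * k ^ 3 + 9 * k ^ 2 + 5 * k + 1, by ring⟩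
  have hp2 : p ≠ 2 := by omega
  obtain ⟨θ, hθ⟩ := MulChar.exists_mulChar_orderOf (ZMod p) h16
    (Complex.isPrimitiveRoot_exp 16 (by norm_num))
  obtain ⟨χ, hχ, hχ1⟩ : ∃ χ : MulChar (ZMod p) ℂ, orderOf χ = 8 ∧ χ (-1) = 1 := by
    refine ⟨θ ^ 2, by rw [orderOf_pow, hθ]; norm_num, ?_⟩
    rw [MulChar.pow_apply' _ two_ne_zero, ← map_pow, neg_one_sq, map_one]
  have hχ8 : χ ^ 8 = 1 := hχ ▸ pow_orderOf_eq_one χ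
  have hne {j : ℕ} (hj : ¬ 8 ∣ j) : χ ^ j ≠ 1 := fun h ↦ hj (hχ ▸ orderOf_dvd_of_pow_eq_one h)
  have hord {j : ℕ} (hj : Nat.Coprime 8 j) : orderOf (χ ^ j) = 8 := by
    rw [Nat.Coprime.orderOf_pow (by rwa [hχ]), hχ]
  obtain ⟨ω, hω⟩ : ∃ ω : ℂ, IsPrimitiveRoot ω 8 := ⟨_, Complex.isPrimitiveRoot_exp 8 (by norm_num)⟩
  have hω4 := pow_four_eq_neg_one_of_primitiveRoot hω
  have hχ4 := octic_apply_four hp hχ hp2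
  obtain ⟨e, he, heC⟩ : ∃ e : ℤ, ((e = 1 ∧ Even (n : ℤ)) ∨ (e = -1 ∧ Odd (n : ℤ))) ∧
      χ 4 = e := by
    rcases Nat.even_or_odd n with h | h
    · exact ⟨1, .inl ⟨rfl, by exact_mod_cast h⟩, by rw [hχ4, h.neg_one_pow]; simp⟩
    · exact ⟨-1, .inr ⟨rfl, by exact_mod_cast h⟩, by rw [hχ4, h.neg_one_pow]; simp⟩
  have he2 : e ^ 2 = 1 := by rcases he with ⟨rfl, -⟩ | ⟨rfl, -⟩ <;> norm_num
  have he2C : (e : ℂ) ^ 2 = 1 := by exact_mod_cast he2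
  have pow4 {j : ℕ} (hj : Odd j) : (χ ^ j) 4 = e := by
    obtain ⟨k, rfl⟩ := hj
    rw [MulChar.pow_apply' _ (by omega), heC, pow_succ, pow_mul, he2C, one_pow, one_mul]
  have powneg {j : ℕ} (hj : j ≠ 0) : (χ ^ j) (-1) = 1 := by
    rw [MulChar.pow_apply' _ hj, hχ1, one_pow]
  have pow_reduce (i : ℕ) : χ ^ (8 + i) = χ ^ i := by rw [pow_add, hχ8, one_mul]
  have h13 := octic_jacobiSum_one_three hp2 hχ hχ1
  have h57 := octic_jacobiSum_one_three hp2 (hord (j := 5) (by norm_num)) (powneg (by norm_num))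
  have h33 := octic_jacobiSum_three_three hp2 hχ hχ1 (by rw [heC, he2C])
  have h77 := octic_jacobiSum_three_three hp2 (hord (j := 5) (by norm_num)) (powneg (by norm_num))
    (by rw [pow4 (by decide), he2C])
  have h15 := octic_jacobiSum_one_five hp2 hχ (by rw [heC, he2C])
  have h37 := octic_jacobiSum_one_five hp2 (hord (j := 3) (by norm_num))
    (by rw [pow4 (by decide), he2C])
  rw [← pow_mul, show 5 * 3 = 8 + 7 from rfl, pow_reduce] at h57 h77
  rw [← pow_mul, ← pow_mul, show 3 * 5 = 8 + 7 from rfl, pow_reduce, show 3 * 2 = 6 from rfl] at h37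
  rw [heC] at h13 h15
  rw [pow4 (by decide)] at h57 h37
  have inv_eq {i j : ℕ} (hij : i + j = 8) : (χ ^ i)⁻¹ = χ ^ j := by
    rw [inv_eq_iff_mul_eq_one, ← pow_add, hij, hχ8]
  have hA := jacobiSum_mul_jacobiSum_inv_eq_prime (hne (j := 1) (by norm_num))
    (by rw [← pow_add]; exact hne (by norm_num))
  have hB := jacobiSum_mul_jacobiSum_inv_eq_prime (hne (j := 2) (by norm_num))
    (by rw [← pow_add]; exact hne (by norm_num))
  rw [inv_eq (j := 7) rfl, pow_one] at hA
  rw [inv_eq (j := 6) rfl] at hB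
  have hM (j : ℕ) (hj : j ≠ 0) := jacobiSum_pow_self_eq_sum_octicCount hχ hω hj
  have heven (k : ℕ) (h : χ 4 * ω ^ k ≠ 1) := even_octicCount hp2 h
  generalize octicCount χ ω = M at hM heven
  have hM1 := hM 1 (by norm_num)
  have hM2 := hM 2 (by norm_num)
  have hM3 := hM 3 (by norm_num)
  have hM5 := hM 5 (by norm_num)
  have hM6 := hM 6 (by norm_num)
  have hM7 := hM 7 (by norm_num)
  have hM8 := hM 8 (by norm_num)
  have hωp (k : ℕ) : ω ^ (k + 4) = -ω ^ k := by rw [pow_add, hω4]; ring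
  rw [hχ8, jacobiSum_one_one, ZMod.card] at hM8
  rw [pow_one] at hM1
  simp only [Finset.sum_range_succ, Finset.sum_range_zero, ← pow_mul] at hM1 hM2 hM3 hM5 hM6 hM7 hM8
  norm_num [hωp] at hM1 hM2 hM3 hM5 hM6 hM7 hM8
  have hlin : 2 * ((M 2 : ℂ) - M 6) * ω ^ 2 = -(((M 1 : ℂ) - M 5) - (M 3 - M 7)) * (ω - ω ^ 3) := by
    linear_combination hM3 - hM1 - h33
  have hsq : 2 * ((M 2 : ℤ) - M 6) ^ 2 + (((M 1 : ℤ) - M 5) - (M 3 - M 7)) ^ 2 = 0 := by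
    have : 2 * (2 * ((M 2 : ℂ) - M 6) ^ 2 + (((M 1 : ℂ) - M 5) - (M 3 - M 7)) ^ 2) = 0 := by
      have h := congrArg (fun z : ℂ ↦ z * z) hlin
      beta_reduce at h
      linear_combination -h + (4 * ((M 2 : ℂ) - M 6) ^ 2 +
        (((M 1 : ℂ) - M 5) - (M 3 - M 7)) ^ 2 * (2 - ω ^ 2)) * hω4
    exact_mod_cast (mul_eq_zero.mp this).resolve_left two_ne_zero
  have m26 : (M 2 : ℤ) = M 6 := by
    have : ((M 2 : ℤ) - M 6) ^ 2 = 0 := by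
      linarith [sq_nonneg ((M 2 : ℤ) - M 6), sq_nonneg (((M 1 : ℤ) - M 5) - (M 3 - M 7))]
    exact sub_eq_zero.mp (pow_eq_zero_iff two_ne_zero |>.mp this)
  have m13 : (M 1 : ℤ) - M 5 = M 3 - M 7 := by
    rw [m26, sub_self] at hsq
    exact sub_eq_zero.mp (pow_eq_zero_iff two_ne_zero |>.mp (by simpa using hsq))
  have m26C : (M 2 : ℂ) = M 6 := by exact_mod_cast m26
  have m13C : (M 1 : ℂ) - M 5 = M 3 - M 7 := by exact_mod_cast m13
  obtain ⟨s, hs⟩ : ∃ s : ℤ, s = M 0 + M 4 - M 2 - M 6 := ⟨_, rfl⟩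
  obtain ⟨t, ht⟩ : ∃ t : ℤ, t = M 1 + M 5 - M 3 - M 7 := ⟨_, rfl⟩
  obtain ⟨u, hu⟩ : ∃ u : ℤ, u = M 0 - M 4 := ⟨_, rfl⟩
  obtain ⟨v, hv⟩ : ∃ v : ℤ, v = M 1 - M 5 := ⟨_, rfl⟩
  have hsC : (s : ℂ) = M 0 + M 4 - M 2 - M 6 := by exact_mod_cast hs
  have htC : (t : ℂ) = M 1 + M 5 - M 3 - M 7 := by exact_mod_cast ht
  have huC : (u : ℂ) = M 0 - M 4 := by exact_mod_cast hu
  have hvC : (v : ℂ) = M 1 - M 5 := by exact_mod_cast hv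
  have k1 : jacobiSum χ χ = u + v * (ω + ω ^ 3) := by
    rw [hM1, huC, hvC]; linear_combination ω ^ 2 * m26C - ω ^ 3 * m13C
  have k5 : jacobiSum (χ ^ 5) (χ ^ 5) = u - v * (ω + ω ^ 3) := by
    rw [hM5, huC, hvC]; linear_combination ω ^ 2 * m26C + ω ^ 3 * m13C
  have k2 : jacobiSum (χ ^ 2) (χ ^ 2) = s + t * ω ^ 2 := by
    rw [hM2, hsC, htC]; ring
  have k6 : jacobiSum (χ ^ 6) (χ ^ 6) = s - t * ω ^ 2 := by
    rw [hM6, hsC, htC]; ring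
  have hpZ : (p : ℤ) = 4 * (n : ℤ) ^ 4 + 12 * (n : ℤ) ^ 2 + 1 := by exact_mod_cast hp
  have hst : s ^ 2 + t ^ 2 = p := by
    rw [k2, k6] at hB
    have : (s : ℂ) ^ 2 + t ^ 2 = p := by linear_combination hB + (t : ℂ) ^ 2 * hω4
    exact_mod_cast this
  have huv : u ^ 2 + 2 * v ^ 2 = p := by
    rw [h77, k1, k5] at hA
    have : (u : ℂ) ^ 2 + 2 * v ^ 2 = p := by
      linear_combination hA + (v : ℂ) ^ 2 * (2 + ω ^ 2) * hω4
    exact_mod_cast this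
  have hsum : (M 0 : ℤ) + M 1 + M 2 + M 3 + M 4 + M 5 + M 6 + M 7 = p - 2 := by
    exact_mod_cast hM8.symm
  have hev {k : ℕ} (hk : ¬ 8 ∣ k * 2) : Even (M k : ℤ) := by
    rw [Int.even_coe_nat]
    refine heven k fun h ↦ hk (hω.dvd_of_pow_eq_one _ ?_)
    have h' := congrArg (· ^ 2) h
    rw [heC, mul_pow, he2C, one_mul, one_pow, ← pow_mul] at h'
    exact h'
  obtain ⟨hes, htv⟩ := octicCount_constraints (n := n) (M := fun k ↦ (M k : ℤ)) he
    (by rw [← hpZ]; exact Nat.prime_iff_prime_int.mp Fact.out) (by rw [hsum, hpZ]; ring)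
    m26 m13 hs ht hu hv (by rw [hst, hpZ]) (by rw [huv, hpZ])
    (fun h ↦ by
      rw [Int.even_coe_nat]; refine heven 0 ?_; rw [heC, h]; norm_num)
    (fun h ↦ by
      rw [Int.even_coe_nat]; refine heven 4 ?_; rw [heC, h, hω4]; norm_num)
    (hev (by norm_num)) (hev (by norm_num)) (hev (by norm_num)) (hev (by norm_num))
    (hev (by norm_num))
  have hω9 : ω ^ 9 = ω := by rw [hωp 5, hωp 1]; ring
  rcases htv with h | h
  · refine ⟨χ, ω, s, t, e * u, e * v, e, hχ, hω, hχ1, he2, h, hes, ?_⟩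
    rw [h13, h57, h15, h37, h33, h77, k1, k5, k2, k6]
    push_cast
    refine ⟨?_, ?_, ?_, ?_, by ring, by ring, rfl, rfl, rfl, rfl⟩
    · linear_combination -(u + v * (ω + ω ^ 3)) * he2C
    · linear_combination -(u + v * (ω + ω ^ 3)) * he2C
    · linear_combination -(u - v * (ω + ω ^ 3)) * he2C
    · linear_combination -(u - v * (ω + ω ^ 3)) * he2C
  · refine ⟨χ, ω ^ 3, s, -t, e * u, e * v, e, hχ, hω.pow_of_coprime 3 (by norm_num), hχ1, he2,
      by linarith, hes, ?_⟩
    rw [h13, h57, h15, h37, h33, h77, k1, k5, k2, k6]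
    have hρ : ω ^ 3 + (ω ^ 3) ^ 3 = ω + ω ^ 3 := by rw [← pow_mul, hω9, add_comm]
    have hω6 : (ω ^ 3) ^ 2 = -ω ^ 2 := by rw [← pow_mul, hωp 2]
    rw [hρ, hω6]
    push_cast
    refine ⟨?_, ?_, ?_, ?_, by ring, by ring, by ring, by ring, by ring, by ring⟩
    · linear_combination -(u + v * (ω + ω ^ 3)) * he2C
    · linear_combination -(u + v * (ω + ω ^ 3)) * he2C
    · linear_combination -(u - v * (ω + ω ^ 3)) * he2C
    · linear_combination -(u - v * (ω + ω ^ 3)) * he2C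

end OcticJacobiSums

section NearFactorization

lemma octic_convolution_identity {p z ω s t a b e : ℂ} {J : ℕ → ℕ → ℂ} (hz : z ^ 8 = 1)
    (hω : ω ^ 4 = -1) (he : e ^ 2 = 1) (ht : t = 2 * b) (ha : a + s = -2 * e)
    (hJ : ∀ i j, J i j = J j i)
    (h11 : J 1 1 = e * (a + b * (ω + ω ^ 3))) (h33 : J 3 3 = e * (a + b * (ω + ω ^ 3)))
    (h55 : J 5 5 = e * (a - b * (ω + ω ^ 3))) (h77 : J 7 7 = e * (a - b * (ω + ω ^ 3)))
    (h13 : J 1 3 = a + b * (ω + ω ^ 3)) (h57 : J 5 7 = a - b * (ω + ω ^ 3))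
    (h22 : J 2 2 = s + t * ω ^ 2) (h66 : J 6 6 = s - t * ω ^ 2)
    (h15 : J 1 5 = e * (s + t * ω ^ 2)) (h37 : J 3 7 = e * (s - t * ω ^ 2))
    (h17 : J 1 7 = -1) (h26 : J 2 6 = -1) (h35 : J 3 5 = -1)
    (h28 : J 2 8 = -1) (h68 : J 6 8 = -1) (h88 : J 8 8 = p - 2) :
    ∑ i ∈ Finset.range 8, ∑ j ∈ Finset.range 8,
      (1 + ω ^ (7 * (i + 1))) * ((1 + ω ^ (7 * (j + 1))) * (-1) ^ (j + 1)) *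
        (z ^ (i + 1 + (j + 1)) * J (i + 1) (j + 1)) = 4 * (p - 1) := by
  have hωp (k : ℕ) : ω ^ (k + 4) = -ω ^ k := by rw [pow_add, hω]; ring
  have hzp (k : ℕ) : z ^ (k + 8) = z ^ k := by rw [pow_add, hz]; ring
  have hJ' (i j : ℕ) (_ : j < i) : J i j = J j i := hJ i j
  obtain rfl : a = -2 * e - s := by linear_combination ha
  subst ht
  simp only [Finset.sum_range_succ, Finset.sum_range_zero]
  norm_num [hωp, hzp, hω, hz, h11, h33, h55, h77, h13, h57, h22, h66, h15, h37, h17, h26, h35,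
    h28, h68, h88, hJ']
  grind

lemma octic_indicator_sum {ω z : ℂ} (hω : IsPrimitiveRoot ω 8) (hz : z = 0 ∨ z ^ 8 = 1)
    [Decidable (z = 1 ∨ z = ω)] :
    ∑ j ∈ Finset.range 8, (1 + ω ^ (7 * (j + 1))) * z ^ (j + 1) =
      if z = 1 ∨ z = ω then 8 else 0 := by
  have geom {w : ℂ} (hw : w = 0 ∨ w ^ 8 = 1) :
      ∑ j ∈ Finset.range 8, w ^ (j + 1) = if w = 1 then 8 else 0 := by
    split_ifs with h
    · simp [h]
    · rcases hw with rfl | hw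
      · simp
      · refine (mul_eq_zero.mp ?_).resolve_left (sub_ne_zero.mpr h)
        simp only [pow_succ _ _, ← Finset.sum_mul]
        rw [← mul_assoc, mul_geom_sum, hw, sub_self, zero_mul]
  have hω8 := hω.pow_eq_one
  have hω1 : ω ≠ 1 := hω.ne_one (by norm_num)
  have hz' : ω ^ 7 * z = 1 ↔ z = ω := by
    constructor <;> intro h
    · linear_combination ω * h - z * hω8
    · rw [h, ← hω8]; ring
  have hw : ω ^ 7 * z = 0 ∨ (ω ^ 7 * z) ^ 8 = 1 := by
    refine hz.imp (fun h ↦ by rw [h, mul_zero]) fun h ↦ ?_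
    rw [mul_pow, h, ← pow_mul, mul_comm 7, pow_mul, hω8, one_pow, one_mul]
  simp only [add_mul, one_mul, pow_mul, ← mul_pow, Finset.sum_add_distrib]
  rw [geom hz, geom hw, if_congr hz' rfl rfl]
  by_cases h1 : z = 1
  · subst h1; simp [hω1.symm]
  · simp [h1]

lemma sum_mulChar_mul_mulChar_sub {F R : Type*} [Field F] [Fintype F] [CommRing R]
    (χ ψ : MulChar F R) {g : F} (hg : g ≠ 0) :
    ∑ x, χ x * ψ (g - x) = χ g * ψ g * jacobiSum χ ψ := by
  rw [jacobiSum, Finset.mul_sum, ← Equiv.sum_comp (Equiv.mulLeft₀ g hg)]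
  refine Finset.sum_congr rfl fun x _ ↦ ?_
  rw [show Equiv.mulLeft₀ g hg x = g * x from rfl, show g - g * x = g * (1 - x) by ring, map_mul, map_mul]
  ring

variable {p : ℕ} [Fact p.Prime] {χ : MulChar (ZMod p) ℂ}

lemma octic_value (hχ : orderOf χ = 8) (x : ZMod p) : χ x = 0 ∨ χ x ^ 8 = 1 := by
  by_cases hx : x = 0
  · exact .inl (by rw [hx, MulChar.map_zero])
  · exact .inr (octic_pow_eq_one hχ hx)

lemma octic_neg_value (hχ : orderOf χ = 8) (x : ZMod p) : -χ x = 0 ∨ (-χ x) ^ 8 = 1 := by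
  rw [neg_eq_zero, Even.neg_pow (by decide)]
  exact octic_value hχ x

lemma sum_octic_character_pow (hχ : orderOf χ = 8) (c : ℕ → ℂ) :
    ∑ x, ∑ j ∈ Finset.range 8, c (j + 1) * χ x ^ (j + 1) = c 8 * (p - 1) := by
  have h (j : ℕ) : ∑ x, χ x ^ (j + 1) = ∑ x, (χ ^ (j + 1)) x :=
    Finset.sum_congr rfl fun x _ ↦ (MulChar.pow_apply' _ j.succ_ne_zero x).symm
  rw [Finset.sum_comm]
  simp only [← Finset.mul_sum, h]
  rw [Finset.sum_range_succ, Finset.sum_eq_zero, zero_add, show 7 + 1 = 8 from rfl,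
    orderOf_dvd_iff_pow_eq_one.mp hχ.dvd, MulChar.sum_one_eq_card_units,
    ZMod.card_units, Nat.cast_sub (Fact.out (p := p.Prime)).one_le]
  · simp
  · intro j hj
    rw [Finset.mem_range] at hj
    rw [MulChar.sum_eq_zero_of_ne_one, mul_zero]
    exact pow_ne_one_of_lt_orderOf j.succ_ne_zero (by omega)

open Classical in
lemma octic_card (hχ : orderOf χ = 8) {ω : ℂ} (hω : IsPrimitiveRoot ω 8) :
    4 * (Finset.univ.filter fun x ↦ χ x = 1 ∨ χ x = ω).card = p - 1 ∧
      4 * (Finset.univ.filter fun x ↦ -χ x = 1 ∨ -χ x = ω).card = p - 1 := by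
  have hω8 := hω.pow_eq_one
  have h1 : (1 : ℂ) + ω ^ (7 * 8) = 2 := by rw [mul_comm, pow_mul, hω8]; norm_num
  have hp1 : ((p - 1 : ℕ) : ℂ) = p - 1 := by
    rw [Nat.cast_sub (Fact.out (p := p.Prime)).one_le, Nat.cast_one]
  have hS := sum_octic_character_pow hχ fun j ↦ 1 + ω ^ (7 * j)
  have hT := sum_octic_character_pow hχ fun j ↦ (1 + ω ^ (7 * j)) * (-1) ^ j
  simp only [mul_assoc _ ((-1 : ℂ) ^ _), ← mul_pow, neg_one_mul] at hT
  simp only [octic_indicator_sum hω (octic_value hχ _),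
    octic_indicator_sum hω (octic_neg_value hχ _), h1, Finset.sum_ite, Finset.sum_const_zero,
    add_zero, Finset.sum_const, nsmul_eq_mul] at hS hT
  constructor
  · have : (4 : ℂ) * (Finset.univ.filter fun x ↦ χ x = 1 ∨ χ x = ω).card = (p - 1 : ℕ) := by
      rw [hp1]; linear_combination hS / 2
    exact_mod_cast this
  · have : (4 : ℂ) * (Finset.univ.filter fun x ↦ -χ x = 1 ∨ -χ x = ω).card = (p - 1 : ℕ) := by
      rw [hp1]; linear_combination hT / 2
    exact_mod_cast this

open Classical in
lemma octic_convolution_card (hχ : orderOf χ = 8) {ω : ℂ} (hω : IsPrimitiveRoot ω 8)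
    {g : ZMod p} (hg : g ≠ 0) :
    64 * ((Finset.univ.filter fun x ↦
      (χ x = 1 ∨ χ x = ω) ∧ (-χ (g - x) = 1 ∨ -χ (g - x) = ω)).card : ℂ) =
    ∑ i ∈ Finset.range 8, ∑ j ∈ Finset.range 8,
      (1 + ω ^ (7 * (i + 1))) * ((1 + ω ^ (7 * (j + 1))) * (-1) ^ (j + 1)) *
        (χ g ^ (i + 1 + (j + 1)) * jacobiSum (χ ^ (i + 1)) (χ ^ (j + 1))) := by
  have h (i j : ℕ) : χ g ^ (i + 1 + (j + 1)) * jacobiSum (χ ^ (i + 1)) (χ ^ (j + 1)) =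
      ∑ x, χ x ^ (i + 1) * χ (g - x) ^ (j + 1) := by
    simp only [← MulChar.pow_apply' _ (Nat.succ_ne_zero _), Nat.succ_eq_add_one,
      sum_mulChar_mul_mulChar_sub _ _ hg]
    rw [MulChar.pow_apply' _ i.succ_ne_zero, MulChar.pow_apply' _ j.succ_ne_zero, pow_add]
  have h' : 64 * ((Finset.univ.filter fun x ↦
      (χ x = 1 ∨ χ x = ω) ∧ (-χ (g - x) = 1 ∨ -χ (g - x) = ω)).card : ℂ) =
      ∑ x, (if χ x = 1 ∨ χ x = ω then (8 : ℂ) else 0) *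
        (if -χ (g - x) = 1 ∨ -χ (g - x) = ω then 8 else 0) := by
    simp only [ite_zero_mul_ite_zero, Finset.sum_ite, Finset.sum_const_zero, add_zero,
      Finset.sum_const, nsmul_eq_mul]
    ring
  rw [h']
  simp only [← octic_indicator_sum hω (octic_value hχ _),
    ← octic_indicator_sum hω (octic_neg_value hχ _), h, Finset.sum_mul_sum]
  simp only [Finset.mul_sum]
  rw [Finset.sum_comm]
  refine Finset.sum_congr rfl fun i _ ↦ ?_
  rw [Finset.sum_comm]
  refine Finset.sum_congr rfl fun j _ ↦ Finset.sum_congr rfl fun x _ ↦ ?_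
  rw [neg_pow (χ (g - x))]
  ring

end NearFactorization

/-- Let `n ≥ 1` be an integer such that `p = 4n⁴ + 12n² + 1` is prime. Then there exist
subsets `S`, `T` of `ℤ/pℤ` with `|S| = |T| = (p-1)/4` forming a `(p-1)/16`-fold
near-factorization of the additive group `ℤ/pℤ`. -/
theorem stmt_17 (n : ℕ) (hn : 1 ≤ n)
    (p : ℕ) (hp : p = 4 * n ^ 4 + 12 * n ^ 2 + 1) (hprime : p.Prime) :
    ∃ S T : Set (ZMod p), S.ncard = (p - 1) / 4 ∧ T.ncard = (p - 1) / 4 ∧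
      ∀ g : ZMod p, g ≠ 0 →
        {st : ZMod p × ZMod p | st.1 ∈ S ∧ st.2 ∈ T ∧ st.1 + st.2 = g}.ncard
          = (p - 1) / 16 := by
  classical
  have : Fact p.Prime := ⟨hprime⟩
  obtain ⟨χ, ω, s, t, a, b, e, hχ, hω, hχ1, he, ht, ha, h11, h33, h55, h77, h13, h57, h22, h66,
    h15, h37⟩ := exists_octic_jacobiSums hn hp
  obtain ⟨hS, hT⟩ := octic_card hχ hω
  refine ⟨{x | χ x = 1 ∨ χ x = ω}, {x | -χ x = 1 ∨ -χ x = ω}, ?_, ?_, fun g hg ↦ ?_⟩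
  · rw [Set.ncard_eq_toFinset_card', Set.toFinset_ofPred]
    omega
  · rw [Set.ncard_eq_toFinset_card', Set.toFinset_ofPred]
    omega
  have hχ8 : χ ^ 8 = 1 := hχ ▸ pow_orderOf_eq_one χ
  have hne {j : ℕ} (hj : ¬ 8 ∣ j) : χ ^ j ≠ 1 := fun h ↦ hj (hχ ▸ orderOf_dvd_of_pow_eq_one h)
  have hinv {i j : ℕ} (hij : i + j = 8) (hi : ¬ 8 ∣ i) : jacobiSum (χ ^ i) (χ ^ j) = -1 := by
    have : χ ^ j = (χ ^ i)⁻¹ := by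
      rw [eq_comm, inv_eq_iff_mul_eq_one, ← pow_add, hij, hχ8]
    rw [this, jacobiSum_nontrivial_inv (hne hi), MulChar.pow_apply' _ (by rintro rfl; simp at hi),
      hχ1, one_pow]
  have hone {i : ℕ} (hi : ¬ 8 ∣ i) : jacobiSum (χ ^ i) (χ ^ 8) = -1 := by
    rw [hχ8, jacobiSum_comm, jacobiSum_one_nontrivial (hne hi)]
  have hcard := (octic_convolution_card hχ hω hg).trans
    (octic_convolution_identity (p := p) (J := fun i j ↦ jacobiSum (χ ^ i) (χ ^ j))
      (octic_pow_eq_one hχ hg) (pow_four_eq_neg_one_of_primitiveRoot hω)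
      (by exact_mod_cast he) (by exact_mod_cast ht) (by exact_mod_cast ha)
      (fun i j ↦ jacobiSum_comm _ _) (by rwa [pow_one]) h33 h55 h77 (by rwa [pow_one]) h57 h22 h66
      (by rwa [pow_one]) h37 (hinv rfl (by norm_num)) (hinv rfl (by norm_num))
      (hinv rfl (by norm_num)) (hone (by norm_num)) (hone (by norm_num))
      (by rw [hχ8, jacobiSum_one_one, ZMod.card]))
  have himage : {st : ZMod p × ZMod p | st.1 ∈ {x | χ x = 1 ∨ χ x = ω} ∧
      st.2 ∈ {x | -χ x = 1 ∨ -χ x = ω} ∧ st.1 + st.2 = g} =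
      (fun x ↦ (x, g - x)) '' {x | (χ x = 1 ∨ χ x = ω) ∧ (-χ (g - x) = 1 ∨ -χ (g - x) = ω)} := by
    ext ⟨x, y⟩
    simp only [Set.mem_ofPred_eq, Set.mem_image, Prod.mk.injEq]
    constructor
    · rintro ⟨hx, hy, rfl⟩
      exact ⟨x, ⟨hx, by rwa [add_sub_cancel_left]⟩, rfl, by ring⟩
    · rintro ⟨x, ⟨hx, hy⟩, rfl, rfl⟩
      exact ⟨hx, hy, by ring⟩
  rw [himage, Set.ncard_image_of_injective _ fun x y h ↦ (Prod.mk.inj h).1,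
    Set.ncard_eq_toFinset_card', Set.toFinset_ofPred]
  have : 16 * (Finset.univ.filter fun x ↦
      (χ x = 1 ∨ χ x = ω) ∧ (-χ (g - x) = 1 ∨ -χ (g - x) = ω)).card + 1 = p := by
    have h : (16 : ℂ) * (Finset.univ.filter fun x ↦
      (χ x = 1 ∨ χ x = ω) ∧ (-χ (g - x) = 1 ∨ -χ (g - x) = ω)).card + 1 = p := by
      linear_combination hcard / 4
    exact_mod_cast h
  omega
end
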